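/- arXiv:2404.13587 — 4 statements merged into one kernel-verified Lean document; each statement's English description precedes it below -/
import Mathlib

section
/- For all integers m ≥ 4 and l ≥ 4, the product S_m × S_l = {(x,y,z,w) ∈ ℝ^m × ℝ^m × ℝ^l × ℝ^l : |x| = |y| and |z| = |w|} is an Almgren minimal set of dimension 2m+2l−2 in ℝ^{2m+2l}. (Instance of Theorem 5.6 1°: the product of two homogeneous area-minimizing hypercones is an Almgren minimal cone, applied to the generalized Simons cones.) -/
open Set MeasureTheory Metric NNReal

noncomputable section

/-- A deformation in an open set `U ⊆ ℝ^N`. -/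
def IsDeformation {N : ℕ} (U : Set (EuclideanSpace ℝ (Fin N)))
    (φ : ℝ → EuclideanSpace ℝ (Fin N) → EuclideanSpace ℝ (Fin N)) : Prop :=
  (∀ t ∈ Icc (0:ℝ) 1, MapsTo (φ t) (closure U) (closure U)) ∧
  (∀ x ∈ closure U, φ 0 x = x) ∧
  ContinuousOn (fun p : ℝ × EuclideanSpace ℝ (Fin N) => φ p.1 p.2)
    (Icc (0:ℝ) 1 ×ˢ closure U) ∧
  (∃ K : ℝ≥0, LipschitzOnWith K (φ 1) (closure U)) ∧
  (closure (⋃ t ∈ Icc (0:ℝ) 1,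
      ({x ∈ closure U | φ t x ≠ x} ∪ φ t '' {x ∈ closure U | φ t x ≠ x})) ⊆ U ∧
    IsCompact (closure (⋃ t ∈ Icc (0:ℝ) 1,
      ({x ∈ closure U | φ t x ≠ x} ∪ φ t '' {x ∈ closure U | φ t x ≠ x}))))

/-- `E` is an Almgren minimal set of dimension `d` in the open set `U`. -/
def AlmgrenMinimal {N : ℕ} (d : ℝ) (U E : Set (EuclideanSpace ℝ (Fin N))) : Prop :=
  IsClosed E ∧ E ⊆ closure U ∧
  (∀ (x : EuclideanSpace ℝ (Fin N)) (r : ℝ), closedBall x r ⊆ U →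
      μH[d] (E ∩ closedBall x r) < ⊤) ∧
  ∀ φ, IsDeformation U φ →
    μH[d] (E \ (φ 1 '' E)) ≤ μH[d] ((φ 1 '' E) \ E)

/-- Sum of squares of the coordinates with index in `[a, b)`. -/
def sumSq {n : ℕ} (z : EuclideanSpace ℝ (Fin n)) (a b : ℕ) : ℝ :=
  ∑ i : Fin n, if a ≤ (i : ℕ) ∧ (i : ℕ) < b then z i ^ 2 else 0

end

noncomputable section

section Brouwer

open Filter Topology

/-- The values of the polynomial `t ↦ det (1 + t M)` at `1` are a fixed linear combination of its
values at any family of `dim V + 1` distinct nodes. -/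
lemma det_one_add_eq_sum_lagrange {V : Type*} [NormedAddCommGroup V] [NormedSpace ℝ V]
    [FiniteDimensional ℝ V] (s : Finset ℝ) (hs : s.card = Module.finrank ℝ V + 1)
    (M : V →L[ℝ] V) :
    (ContinuousLinearMap.id ℝ V + M).det =
      ∑ t ∈ s, (Lagrange.basis s id t).eval 1 * (ContinuousLinearMap.id ℝ V + t • M).det := by
  classical
  let b := Module.finBasis ℝ V
  let A : Matrix (Fin (Module.finrank ℝ V)) (Fin (Module.finrank ℝ V)) ℝ :=
    LinearMap.toMatrix b b (M : V →ₗ[ℝ] V)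
  let I : Matrix (Fin (Module.finrank ℝ V)) (Fin (Module.finrank ℝ V)) ℝ := 1
  let p : Polynomial ℝ :=
    ((Polynomial.X : Polynomial ℝ) • A.map (Polynomial.C (R := ℝ)) + I.map (Polynomial.C (R := ℝ))).det
  have hp : ∀ t : ℝ, (ContinuousLinearMap.id ℝ V + t • M).det = p.eval t := by
    intro t
    have h1 : (ContinuousLinearMap.id ℝ V + t • M).det = (1 + t • A).det := by
      rw [ContinuousLinearMap.det, ← LinearMap.det_toMatrix b]
      congr 1
      simp [A]
    rw [h1]
    simp only [p]
    rw [← Polynomial.coe_evalRingHom, RingHom.map_det]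
    congr 1
    ext i j
    simp [I, Matrix.one_apply, add_comm]
    split_ifs <;> simp [mul_comm]
  have hdeg : p.degree < s.card := by
    refine lt_of_le_of_lt Polynomial.degree_le_natDegree ?_
    rw [hs]
    have := Polynomial.natDegree_det_X_add_C_le A I
    rw [Fintype.card_fin] at this
    exact_mod_cast Nat.lt_succ_of_le this
  have key := Lagrange.eq_interpolate (s := s) (v := id) (f := p)
    Function.injective_id.injOn hdeg
  have h1 := hp 1
  rw [one_smul] at h1
  rw [h1, key, Lagrange.interpolate_apply, Polynomial.eval_finsetSum]
  refine Finset.sum_congr rfl fun t _ => ?_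
  simp only [Polynomial.eval_mul, Polynomial.eval_C, id]
  rw [hp t, mul_comm]

lemma sum_lagrange_eval_one (s : Finset ℝ) (hs : s.Nonempty) :
    ∑ t ∈ s, (Lagrange.basis s id t).eval 1 = 1 := by
  rw [← Polynomial.eval_finsetSum, Lagrange.sum_basis Function.injective_id.injOn hs]
  simp

lemma exists_pos_det_pos (V : Type*) [NormedAddCommGroup V] [NormedSpace ℝ V]
    [FiniteDimensional ℝ V] :
    ∃ δ > 0, ∀ M : V →L[ℝ] V, ‖M‖ < δ → 0 < (ContinuousLinearMap.id ℝ V + M).det := by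
  have hc : Continuous fun M : V →L[ℝ] V => (ContinuousLinearMap.id ℝ V + M).det :=
    ContinuousLinearMap.continuous_det.comp (continuous_const.add continuous_id)
  have h0 : 0 < (fun M : V →L[ℝ] V => (ContinuousLinearMap.id ℝ V + M).det) 0 := by
    simp [ContinuousLinearMap.det]
  have := hc.continuousAt.eventually (lt_mem_nhds h0)
  obtain ⟨δ, hδ, h⟩ := Metric.eventually_nhds_iff.1 this
  exact ⟨δ, hδ, fun M hM => h (by simpa using hM)⟩

/-- A small Lipschitz perturbation of the identity supported in a ball permutes this ball. -/
lemma image_id_add_eq {V : Type*} [NormedAddCommGroup V] [CompleteSpace V]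
    {g : V → V} {K : ℝ≥0} (hg : LipschitzWith K g) (hK : K < 1) {B : Set V}
    (hB : ∀ x ∉ B, g x = 0) :
    InjOn (fun x => x + g x) B ∧ (fun x => x + g x) '' B = B := by
  have hinj : Function.Injective (fun x => x + g x) := by
    intro x y hxy
    have h1 : dist x y ≤ K * dist x y := by
      calc dist x y = dist (g x) (g y) := by
            rw [dist_comm (g x), dist_eq_norm, dist_eq_norm]
            congr 1
            have : x + g x = y + g y := hxy
            rw [sub_eq_sub_iff_add_eq_add, this, add_comm]
        _ ≤ K * dist x y := hg.dist_le_mul x y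
    have hK' : (K : ℝ) < 1 := hK
    have : dist x y ≤ 0 := by nlinarith [dist_nonneg (x := x) (y := y)]
    exact dist_le_zero.1 this
  have hsurj : Function.Surjective (fun x => x + g x) := by
    intro y
    have hc : ContractingWith K (fun x => y - g x) := by
      refine ⟨hK, LipschitzWith.of_dist_le_mul fun a b => ?_⟩
      rw [dist_sub_left]
      exact hg.dist_le_mul a b
    refine ⟨hc.fixedPoint, ?_⟩
    have := hc.fixedPoint_isFixedPt
    simp only [Function.IsFixedPt] at this
    simp only
    nth_rewrite 1 [← this]
    abel
  refine ⟨hinj.injOn, Subset.antisymm ?_ ?_⟩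
  · rintro _ ⟨x, hx, rfl⟩
    by_contra h
    have h2 : (fun x => x + g x) ((fun x => x + g x) x) = (fun x => x + g x) x := by
      simp only at h ⊢
      rw [hB _ h, add_zero]
    rw [hinj h2] at h
    exact h hx
  · intro y hy
    obtain ⟨x, rfl⟩ := hsurj y
    by_cases hx : x ∈ B
    · exact ⟨x, hx, rfl⟩
    · simp only [hB x hx, add_zero] at hy
      exact absurd hy hx

/-- If `G` is Lipschitz and vanishes outside a ball, then the Jacobian determinant of `id + G` has
mean value one over this ball. -/
lemma integral_det_id_add {V : Type*} [NormedAddCommGroup V] [NormedSpace ℝ V]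
    [FiniteDimensional ℝ V] [MeasurableSpace V] [BorelSpace V]
    {G : V → V} {K : ℝ≥0} (hG : LipschitzWith K G) {R : ℝ}
    (hR : ∀ x ∉ closedBall (0 : V) R, G x = 0) :
    ∫ x in closedBall (0 : V) R, (ContinuousLinearMap.id ℝ V + fderiv ℝ G x).det
        ∂(μH[Module.finrank ℝ V] : Measure V) =
      (μH[Module.finrank ℝ V] : Measure V).real (closedBall (0 : V) R) := by
  set μ : Measure V := μH[Module.finrank ℝ V]
  set B := closedBall (0 : V) R
  have hd : ∀ᵐ x ∂μ, DifferentiableAt ℝ G x := hG.ae_differentiableAt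
  have hBfin : μ B ≠ ⊤ := (isCompact_closedBall _ _).measure_ne_top
  obtain ⟨δ, hδ, hdet⟩ := exists_pos_det_pos V
  have hint : ∀ t : ℝ, IntegrableOn
      (fun x => (ContinuousLinearMap.id ℝ V + t • fderiv ℝ G x).det) B μ := by
    intro t
    have hc : Continuous fun M : V →L[ℝ] V => (ContinuousLinearMap.id ℝ V + t • M).det :=
      ContinuousLinearMap.continuous_det.comp
        (by fun_prop)
    obtain ⟨C, hC⟩ := (isCompact_closedBall (0 : V →L[ℝ] V) K).exists_bound_of_continuousOn
      hc.continuousOn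
    have : IsFiniteMeasure (μ.restrict B) := ⟨by simpa using hBfin.lt_top⟩
    refine Integrable.of_bound (C := C) ?_ ?_
    · exact (hc.measurable.comp (measurable_fderiv ℝ G)).aestronglyMeasurable
    · refine Eventually.of_forall fun x => hC _ ?_
      rw [mem_closedBall_zero_iff]
      exact norm_fderiv_le_of_lipschitz ℝ hG
  have hsmall : ∀ t : ℝ, 0 < t → t * K < 1 → t * K < δ →
      ∫ x in B, (ContinuousLinearMap.id ℝ V + t • fderiv ℝ G x).det ∂μ = μ.real B := by
    intro t ht h1 h2
    let S := B ∩ {x | DifferentiableAt ℝ G x}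
    have hS : MeasurableSet S :=
      isClosed_closedBall.measurableSet.inter (measurableSet_of_differentiableAt ℝ G)
    have htG : LipschitzWith (t.toNNReal * K) (fun x => t • G x) := by
      refine LipschitzWith.of_dist_le_mul fun x y => ?_
      rw [dist_smul₀, Real.norm_eq_abs, abs_of_pos ht]
      rw [NNReal.coe_mul, Real.coe_toNNReal _ ht.le, mul_assoc]
      exact mul_le_mul_of_nonneg_left (hG.dist_le_mul x y) ht.le
    have hK1 : t.toNNReal * K < 1 := by
      rw [← NNReal.coe_lt_coe, NNReal.coe_mul, Real.coe_toNNReal _ ht.le]; exact h1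
    obtain ⟨hinj, himg⟩ := image_id_add_eq htG hK1 (B := B) (fun x hx => by simp [hR x hx])
    have hae : S =ᵐ[μ] B := by
      refine (Filter.inter_eventuallyEq_left (s := B)).2 ?_
      filter_upwards [hd] with x hx _ using hx
    have hder : ∀ x ∈ S, HasFDerivWithinAt (fun x => x + t • G x)
        (ContinuousLinearMap.id ℝ V + t • fderiv ℝ G x) S x := by
      intro x hx
      have : HasFDerivAt G (fderiv ℝ G x) x := DifferentiableAt.hasFDerivAt hx.2
      exact ((hasFDerivAt_id x).add (this.const_smul t)).hasFDerivWithinAt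
    have hcov := integral_image_eq_integral_abs_det_fderiv_smul μ hS hder
      (hinj.mono inter_subset_left) (fun _ => (1 : ℝ))
    have hnull : μ ((fun x => x + t • G x) '' (B \ S)) = 0 := by
      have hl : LipschitzWith (1 + t.toNNReal * K) (fun x => x + t • G x) :=
        LipschitzWith.id.add htG
      have hz : μ (B \ S) = 0 := ae_le_set.1 hae.symm.le
      refine le_antisymm ((hl.hausdorffMeasure_image_le (Nat.cast_nonneg _) _).trans ?_) bot_le
      rw [show μH[(Module.finrank ℝ V : ℝ)] (B \ S) = 0 from hz, mul_zero]
    have himS : μ ((fun x => x + t • G x) '' S) = μ B := by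
      refine le_antisymm ?_ ?_
      · exact (measure_mono (image_mono inter_subset_left)).trans_eq (congrArg μ himg)
      · refine (congrArg μ himg).symm.trans_le ?_
        rw [← union_sdiff_cancel (inter_subset_left : S ⊆ B), image_union]
        refine (measure_union_le _ _).trans ?_
        rw [hnull, add_zero]
    rw [← setIntegral_congr_set hae]
    have habs : ∀ x, |(ContinuousLinearMap.id ℝ V + t • fderiv ℝ G x).det| =
        (ContinuousLinearMap.id ℝ V + t • fderiv ℝ G x).det := by
      intro x
      refine abs_of_pos (hdet _ ?_)
      refine lt_of_le_of_lt ?_ h2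
      rw [norm_smul, Real.norm_eq_abs, abs_of_pos ht]
      exact mul_le_mul_of_nonneg_left (norm_fderiv_le_of_lipschitz ℝ hG) ht.le
    simp only [habs, smul_eq_mul, mul_one, setIntegral_const] at hcov
    rw [← hcov, measureReal_def, himS, measureReal_def]
  obtain ⟨t₀, ht₀, h1, h2⟩ : ∃ t₀ : ℝ, 0 < t₀ ∧ t₀ * K < 1 ∧ t₀ * K < δ := by
    have hp : 0 < min 1 δ := lt_min one_pos hδ
    refine ⟨min 1 δ / (K + 1), by positivity, ?_, ?_⟩
    all_goals
      rw [div_mul_eq_mul_div, div_lt_iff₀ (by positivity)]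
      nlinarith [min_le_left 1 δ, min_le_right 1 δ, K.2, hδ]
  obtain ⟨s, hsub, hcard⟩ : ∃ s : Finset ℝ, (s : Set ℝ) ⊆ Ioo 0 t₀ ∧
      s.card = Module.finrank ℝ V + 1 :=
    (Ioo_infinite ht₀).exists_subset_card_eq _
  have hne : s.Nonempty := Finset.card_pos.1 (by omega)
  rw [integral_congr_ae (ae_of_all _ fun x => det_one_add_eq_sum_lagrange s hcard _)]
  rw [integral_finsetSum s fun t _ => (hint t).const_mul _]
  simp_rw [integral_const_mul]
  rw [Finset.sum_congr rfl fun t ht => by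
    rw [hsmall t (hsub ht).1
      ((mul_le_mul_of_nonneg_right (hsub ht).2.le K.2).trans_lt h1)
      ((mul_le_mul_of_nonneg_right (hsub ht).2.le K.2).trans_lt h2)]]
  rw [← Finset.sum_mul, sum_lagrange_eval_one s hne, one_mul]

/-- There is no Lipschitz map which is the identity outside a ball and maps this ball to its
boundary sphere. -/
lemma not_lipschitz_retraction {V : Type*} [NormedAddCommGroup V] [InnerProductSpace ℝ V]
    [FiniteDimensional ℝ V] {H : V → V} {K : ℝ≥0} (hH : LipschitzWith K H) {R : ℝ}
    (hR : 0 < R) (hout : ∀ x, R ≤ ‖x‖ → H x = x) (hin : ∀ x, ‖x‖ ≤ R → ‖H x‖ = R) : False := by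
  let _ : MeasurableSpace V := borel V
  have : BorelSpace V := ⟨rfl⟩
  set μ : Measure V := μH[Module.finrank ℝ V]
  have hG : LipschitzWith (K + 1) (fun x => H x - x) := hH.sub LipschitzWith.id
  have hint := integral_det_id_add hG (R := R) (fun x hx => by
    rw [mem_closedBall_zero_iff, not_le] at hx
    rw [hout x hx.le, sub_self])
  have hd : ∀ᵐ x ∂μ, DifferentiableAt ℝ (fun x => H x - x) x := hG.ae_differentiableAt
  have hs : ∀ᵐ x ∂μ, x ∉ sphere (0 : V) R :=
    measure_eq_zero_iff_ae_notMem.1 (Measure.addHaar_sphere_of_ne_zero μ 0 hR.ne')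
  rw [setIntegral_congr_ae (g := fun _ => (0 : ℝ)) isClosed_closedBall.measurableSet ?_] at hint
  · rw [integral_zero] at hint
    have h2 : 0 < μ.real (closedBall (0 : V) R) :=
      ENNReal.toReal_pos (measure_closedBall_pos μ _ hR).ne'
        (isCompact_closedBall _ _).measure_ne_top
    exact h2.ne hint
  · filter_upwards [hd, hs] with x hx hxs hxB
    have hlt : ‖x‖ < R := lt_of_le_of_ne (mem_closedBall_zero_iff.1 hxB)
      (fun h => hxs (mem_sphere_zero_iff_norm.2 h))
    set A := ContinuousLinearMap.id ℝ V + fderiv ℝ (fun x => H x - x) x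
    have hA : HasFDerivAt H A x := by
      have h := (hasFDerivAt_id x).add hx.hasFDerivAt
      refine h.congr_of_eventuallyEq (Eventually.of_forall fun y => ?_)
      simp
    have hconst : (fun y => ‖H y‖ ^ 2) =ᶠ[𝓝 x] fun _ => R ^ 2 := by
      filter_upwards [(isOpen_lt continuous_norm continuous_const).mem_nhds hlt] with y hy
      rw [hin y (le_of_lt hy)]
    have h1 := hA.norm_sq.unique ((hasFDerivAt_const (R ^ 2) x).congr_of_eventuallyEq hconst)
    have horth : ∀ v, inner ℝ (H x) (A v) = 0 := by
      intro v
      have := congrArg (fun L : V →L[ℝ] ℝ => L v) h1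
      simpa using this
    by_contra hdet
    have hdet' : LinearMap.det (A : V →ₗ[ℝ] V) ≠ 0 := hdet
    have hsurj : Function.Surjective (A : V →ₗ[ℝ] V) :=
      ((LinearMap.isUnit_iff_isUnit_det _).2 (isUnit_iff_ne_zero.2 hdet')) |>
        (Module.End.isUnit_iff _).1 |>.surjective
    obtain ⟨v, hv⟩ := hsurj (H x)
    have h3 := horth v
    rw [show A v = H x from hv, real_inner_self_eq_norm_sq, hin x hlt.le] at h3
    exact hR.ne' (pow_eq_zero_iff two_ne_zero |>.1 h3)

lemma norm_inv_smul_sub_le {V : Type*} [NormedAddCommGroup V] [NormedSpace ℝ V] {δ : ℝ}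
    (hδ : 0 < δ) {x y : V} (hx : δ ≤ ‖x‖) (hy : δ ≤ ‖y‖) :
    ‖‖x‖⁻¹ • x - ‖y‖⁻¹ • y‖ ≤ 2 / δ * ‖x - y‖ := by
  have hx0 : 0 < ‖x‖ := hδ.trans_le hx
  have hy0 : 0 < ‖y‖ := hδ.trans_le hy
  have h : ‖x‖⁻¹ • x - ‖y‖⁻¹ • y = ‖x‖⁻¹ • ((x - y) + ((‖y‖ - ‖x‖) * ‖y‖⁻¹) • y) := by
    rw [smul_add, smul_sub, smul_smul,
      show ‖x‖⁻¹ * ((‖y‖ - ‖x‖) * ‖y‖⁻¹) = ‖x‖⁻¹ - ‖y‖⁻¹ by field_simp, sub_smul]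
    abel
  rw [h, norm_smul, norm_inv, norm_norm]
  have h2 : ‖(x - y) + ((‖y‖ - ‖x‖) * ‖y‖⁻¹) • y‖ ≤ 2 * ‖x - y‖ := by
    refine (norm_add_le _ _).trans ?_
    rw [norm_smul, norm_mul, norm_inv, norm_norm, mul_assoc, inv_mul_cancel₀ hy0.ne', mul_one]
    have := abs_norm_sub_norm_le y x
    rw [norm_sub_rev y x] at this
    rw [Real.norm_eq_abs]
    linarith
  calc ‖x‖⁻¹ * _ ≤ δ⁻¹ * (2 * ‖x - y‖) := by gcongr
    _ = _ := by ring

/-- A continuous self-map which is the identity outside a ball has a zero. -/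
lemma exists_zero_of_eq_id_outside {V : Type*} [NormedAddCommGroup V] [InnerProductSpace ℝ V]
    [FiniteDimensional ℝ V] {F : V → V} (hF : Continuous F) {R : ℝ} (hR : 0 < R)
    (hout : ∀ x, R ≤ ‖x‖ → F x = x) : ∃ x, F x = 0 := by
  by_contra! hne
  let _ : MeasurableSpace V := borel V
  have : BorelSpace V := ⟨rfl⟩
  set μ : Measure V := μH[Module.finrank ℝ V]
  obtain ⟨δ, hδ, hδF⟩ : ∃ δ > 0, ∀ x, δ ≤ ‖F x‖ := by
    obtain ⟨x₀, -, hx₀⟩ := (isCompact_closedBall (0 : V) R).exists_isMinOn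
      ⟨0, by simpa using hR.le⟩ hF.norm.continuousOn
    refine ⟨min ‖F x₀‖ R, lt_min (norm_pos_iff.2 (hne _)) hR, fun x => ?_⟩
    rcases le_total ‖x‖ R with h | h
    · exact (min_le_left _ _).trans (hx₀ (by simpa using h))
    · rw [hout x h]; exact (min_le_right _ _).trans h
  have hGc : Continuous fun x => F x - x := hF.sub continuous_id
  have hGs : HasCompactSupport fun x => F x - x := by
    refine HasCompactSupport.intro (isCompact_closedBall (0 : V) R) fun x hx => ?_
    rw [mem_closedBall_zero_iff, not_le] at hx
    rw [hout x hx.le, sub_self]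
  obtain ⟨η, hη, hηG⟩ := Metric.uniformContinuous_iff.1
    (hGs.uniformContinuous_of_continuous hGc) (δ / 2) (by positivity)
  let φ : ContDiffBump (0 : V) := ⟨η / 2, η, by positivity, by linarith⟩
  let G : V → V := convolution (φ.normed μ) (fun x => F x - x) (ContinuousLinearMap.lsmul ℝ ℝ) μ
  have hGapprox : ∀ x, dist (G x) (F x - x) ≤ δ / 2 := fun x =>
    φ.dist_normed_convolution_le hGc.aestronglyMeasurable fun y hy => (hηG hy).le
  have hGsupp : HasCompactSupport G := φ.hasCompactSupport_normed.convolution _ hGs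
  have hGdiff : ContDiff ℝ (1 : ℕ∞) G :=
    φ.hasCompactSupport_normed.contDiff_convolution_left _ φ.contDiff_normed
      hGc.locallyIntegrable
  obtain ⟨C, hC⟩ := hGdiff.lipschitzWith_of_hasCompactSupport hGsupp (by simp)
  obtain ⟨R₁, hR₁⟩ := hGsupp.isCompact.isBounded.subset_closedBall (0 : V)
  have hG0 : ∀ x, R₁ < ‖x‖ → G x = 0 := fun x hx => by
    by_contra h
    have := hR₁ (subset_tsupport _ h)
    rw [mem_closedBall_zero_iff] at this
    linarith
  obtain ⟨M, hM⟩ := (isCompact_closedBall (0 : V) R₁).exists_bound_of_continuousOn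
    (continuous_id.add hC.continuous).continuousOn
  set E : V → V := fun x => x + G x
  have hE : ∀ x, δ / 2 ≤ ‖E x‖ := by
    intro x
    have h1 := hGapprox x
    have h2 := hδF x
    rw [dist_eq_norm] at h1
    have h3 : F x = E x - (G x - (F x - x)) := by simp only [E]; abel
    have h4 := norm_sub_le (E x) (G x - (F x - x))
    rw [← h3] at h4
    linarith
  have hElip : LipschitzWith (1 + C) E := LipschitzWith.id.add hC
  set ρ : ℝ := max (R₁ + 1) (max M 1)
  have hρ1 : R₁ < ρ := lt_of_lt_of_le (by linarith) (le_max_left _ _)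
  have hρM : M ≤ ρ := (le_max_left _ _).trans (le_max_right _ _)
  have hρ0 : 0 < ρ := lt_of_lt_of_le one_pos ((le_max_right _ _).trans (le_max_right _ _))
  have hEin : ∀ x, ‖x‖ ≤ ρ → ‖E x‖ ≤ ρ := by
    intro x hx
    rcases le_or_gt ‖x‖ R₁ with h | h
    · exact (hM x (by simpa using h)).trans hρM
    · simp only [E]; rwa [hG0 x h, add_zero]
  let H : V → V := fun x => E x + max (ρ - ‖E x‖) 0 • (‖E x‖⁻¹ • E x)
  have hHlip : LipschitzWith (Real.toNNReal ((1 + C) + ((1 + C) + ρ * (2 / (δ / 2) * (1 + C))))) H := by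
    refine LipschitzWith.of_dist_le_mul fun x y => ?_
    rw [Real.coe_toNNReal _ (by positivity)]
    have h0 : ‖E x - E y‖ ≤ (1 + C) * dist x y := by
      have := hElip.dist_le_mul x y
      rwa [dist_eq_norm] at this
    have h1 := norm_inv_smul_sub_le (half_pos hδ) (hE x) (hE y)
    have hunit : ‖‖E x‖⁻¹ • E x‖ = 1 := by
      have : 0 < ‖E x‖ := (half_pos hδ).trans_le (hE x)
      rw [norm_smul, norm_inv, norm_norm, inv_mul_cancel₀ this.ne']
    have h2 : |max (ρ - ‖E x‖) 0 - max (ρ - ‖E y‖) 0| ≤ ‖E x - E y‖ := by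
      refine (abs_max_sub_max_le_abs _ _ _).trans ?_
      rw [sub_sub_sub_cancel_left, abs_sub_comm]
      exact abs_norm_sub_norm_le _ _
    have h3 : |max (ρ - ‖E y‖) 0| ≤ ρ := by
      rw [abs_of_nonneg (le_max_right _ _)]
      exact max_le (by linarith [norm_nonneg (E y)]) hρ0.le
    have h4 : H x - H y = (E x - E y) +
        ((max (ρ - ‖E x‖) 0 - max (ρ - ‖E y‖) 0) • (‖E x‖⁻¹ • E x) +
          max (ρ - ‖E y‖) 0 • (‖E x‖⁻¹ • E x - ‖E y‖⁻¹ • E y)) := by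
      simp only [H, sub_smul, smul_sub]; abel
    rw [dist_eq_norm (H x), h4]
    calc _ ≤ ‖E x - E y‖ + (‖E x - E y‖ * 1 + ρ * (2 / (δ / 2) * ‖E x - E y‖)) := by
          refine (norm_add_le _ _).trans (add_le_add le_rfl ((norm_add_le _ _).trans ?_))
          rw [norm_smul _ (‖E x‖⁻¹ • E x), hunit, norm_smul (max (ρ - ‖E y‖) 0)]
          exact add_le_add (mul_le_mul_of_nonneg_right h2 zero_le_one)
            (mul_le_mul h3 h1 (norm_nonneg _) hρ0.le)
      _ = (1 + (1 + ρ * (2 / (δ / 2)))) * ‖E x - E y‖ := by ring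
      _ ≤ (1 + (1 + ρ * (2 / (δ / 2)))) * ((1 + C) * dist x y) := by gcongr
      _ = _ := by ring
  refine not_lipschitz_retraction hHlip hρ0 (fun x hx => ?_) (fun x hx => ?_)
  · have h1 : E x = x := by simp only [E]; rw [hG0 x (by linarith), add_zero]
    simp only [H, h1]
    rw [max_eq_right (by linarith), zero_smul, add_zero]
  · have h1 := hEin x hx
    have h2 : 0 < ‖E x‖ := (half_pos hδ).trans_le (hE x)
    have h3 : H x = (ρ * ‖E x‖⁻¹) • E x := by
      simp only [H]
      rw [max_eq_left (by linarith), smul_smul, sub_mul, mul_inv_cancel₀ h2.ne', sub_smul, one_smul]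
      abel
    rw [h3, norm_smul, norm_mul, norm_inv, norm_norm, mul_assoc, inv_mul_cancel₀ h2.ne', mul_one,
      Real.norm_eq_abs, abs_of_pos hρ0]

/-- Persistence of a nondegenerate zero: if `Φ` has a unique zero `p` and is close to the identity
there, then every continuous map that agrees with `Φ` outside a ball has a zero. -/
lemma exists_zero_of_eq_outside {V : Type*} [NormedAddCommGroup V] [InnerProductSpace ℝ V]
    [FiniteDimensional ℝ V] {Φ T : V → V} (hΦ : Continuous Φ) (hT : Continuous T) {p : V}
    (huniq : ∀ x, Φ x = 0 → x = p) (hder : HasFDerivAt Φ (ContinuousLinearMap.id ℝ V) p)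
    (hp : Φ p = 0) {R : ℝ} (hout : ∀ x, R ≤ ‖x - p‖ → T x = Φ x) : ∃ x, T x = 0 := by
  by_contra! hne
  obtain ⟨ε, hε, hεR, hloc⟩ : ∃ ε > 0, ε < max R 1 ∧
      ∀ w : V, ‖w‖ ≤ ε → ‖Φ (p + w) - w‖ ≤ 1 / 2 * ‖w‖ := by
    have h := (hasFDerivAt_iff_isLittleO_nhds_zero.1 hder).bound (show (0 : ℝ) < 1 / 2 by norm_num)
    obtain ⟨ε, hε, h⟩ := Metric.eventually_nhds_iff.1 h
    refine ⟨min (ε / 2) (1 / 2), by positivity, ?_, fun w hw => ?_⟩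
    · exact lt_of_le_of_lt (min_le_right _ _) (lt_of_lt_of_le (by norm_num) (le_max_right _ _))
    · have := h (y := w) (by
        rw [dist_zero_right]
        exact lt_of_le_of_lt (hw.trans (min_le_left _ _)) (by linarith))
      simpa [hp] using this
  set ρ := max R 1
  have hρ : 0 < ρ := lt_of_lt_of_le one_pos (le_max_right _ _)
  have hout' : ∀ x, ρ ≤ ‖x - p‖ → T x = Φ x := fun x hx => hout x ((le_max_left _ _).trans hx)
  set r := ε ^ 2 / ρ
  have hr : 0 < r := by positivity
  have hrε : r < ε := by
    simp only [r]; rw [div_lt_iff₀ hρ]; nlinarith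
  let w : V → V := fun v => (ε ^ 2 / max ‖v‖ r ^ 2) • v
  have hw : Continuous w := by
    refine Continuous.smul (Continuous.div continuous_const (by fun_prop) fun v => ?_) continuous_id
    have : 0 < max ‖v‖ r := lt_max_of_lt_right hr
    positivity
  have hwnorm : ∀ v, r ≤ ‖v‖ → ‖w v‖ = ε ^ 2 / ‖v‖ := by
    intro v hv
    have : 0 < ‖v‖ := hr.trans_le hv
    simp only [w]
    rw [max_eq_left hv, norm_smul, Real.norm_eq_abs, abs_of_nonneg (by positivity)]
    field_simp
  let M : V → V := fun v => if ‖v‖ ≤ r then T (p + w v) else Φ (p + w v)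
  have hM : Continuous M := by
    refine Continuous.if_le (by fun_prop) (by fun_prop) continuous_norm continuous_const
      fun v hv => hout' _ ?_
    rw [add_sub_cancel_left, hwnorm v hv.ge, hv]
    simp only [r]
    field_simp
    exact le_rfl
  let F : V → V := fun v => if ‖v‖ ≤ ε then M v else
    v + max (1 - (‖v‖ - ε) / ε) 0 • (M v - w v)
  have hF : Continuous F := by
    refine Continuous.if_le hM (by fun_prop) continuous_norm continuous_const fun v hv => ?_
    have h1 : w v = v := by
      simp only [w]
      rw [max_eq_left (by linarith), hv, div_self (by positivity), one_smul]
    rw [hv, sub_self, zero_div, sub_zero, max_eq_left zero_le_one, one_smul, h1]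
    abel
  obtain ⟨v, hv⟩ := exists_zero_of_eq_id_outside hF (R := 2 * ε) (by positivity) (fun v hv => by
    simp only [F]
    rw [if_neg (by linarith), max_eq_right, zero_smul, add_zero]
    rw [sub_nonpos, le_div_iff₀ hε]
    linarith)
  simp only [F] at hv
  split_ifs at hv with h1
  · simp only [M] at hv
    split_ifs at hv with h2
    · exact hne _ hv
    · have h3 := huniq _ hv
      have h4 := hwnorm v (not_le.1 h2).le
      rw [add_eq_left.1 h3, norm_zero] at h4
      have : 0 < ‖v‖ := hr.trans (not_le.1 h2)
      have : 0 < ε ^ 2 / ‖v‖ := by positivity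
      linarith
  · have h1' := not_le.1 h1
    have hMv : M v = Φ (p + w v) := by
      simp only [M]; rw [if_neg (by linarith)]
    have hwv : ‖w v‖ ≤ ε := by
      rw [hwnorm v (by linarith), div_le_iff₀ (by linarith)]; nlinarith
    have h2 := hloc _ hwv
    rw [hMv] at hv
    set c := max (1 - (‖v‖ - ε) / ε) 0
    have hc0 : 0 ≤ c := le_max_right _ _
    have hc1 : c ≤ 1 := max_le (by
      have : 0 ≤ (‖v‖ - ε) / ε := div_nonneg (by linarith) hε.le
      linarith) zero_le_one
    have h3 : ‖v‖ = c * ‖Φ (p + w v) - w v‖ := by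
      rw [eq_neg_of_add_eq_zero_left hv, norm_neg, norm_smul, Real.norm_eq_abs, abs_of_nonneg hc0,
        ← eq_neg_of_add_eq_zero_left hv]
    nlinarith [norm_nonneg (Φ (p + w v) - w v)]

end Brouwer

section Profile

open Filter Topology

/-- The quadratic form `6st - s² - t²`, positive exactly on the sector around the diagonal where the
retraction onto the cone is nondegenerate. -/
def sectorForm (s t : ℝ) : ℝ := 6 * s * t - s ^ 2 - t ^ 2

/-- The distance to the origin of the retraction of a point whose two components have squared norms
`s` and `t`. -/
def profile (s t : ℝ) : ℝ := ((s + t) * max (sectorForm s t) 0 ^ 3) ^ (1 / 14 : ℝ)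

lemma sectorForm_comm (s t : ℝ) : sectorForm s t = sectorForm t s := by
  unfold sectorForm; ring

lemma profile_comm (s t : ℝ) : profile s t = profile t s := by
  unfold profile; rw [sectorForm_comm, add_comm]

lemma pos_of_sectorForm_pos {s t : ℝ} (ht : 0 ≤ t) (h : 0 < sectorForm s t) : 0 < s := by
  unfold sectorForm at h
  by_contra! hs
  nlinarith [mul_nonneg (neg_nonneg.2 hs) ht, sq_nonneg s, sq_nonneg t]

lemma continuous_sectorForm : Continuous fun p : ℝ × ℝ => sectorForm p.1 p.2 := by
  unfold sectorForm; fun_prop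

lemma continuous_profile : Continuous fun p : ℝ × ℝ => profile p.1 p.2 := by
  unfold profile
  refine Continuous.rpow_const ?_ fun _ => Or.inr (by norm_num)
  exact (continuous_fst.add continuous_snd).mul
    ((continuous_sectorForm.max continuous_const).pow 3)

lemma profile_nonneg {s t : ℝ} (hs : 0 ≤ s) (ht : 0 ≤ t) : 0 ≤ profile s t :=
  Real.rpow_nonneg (mul_nonneg (add_nonneg hs ht) (by positivity)) _

lemma profile_pow {s t : ℝ} (hs : 0 ≤ s) (ht : 0 ≤ t) :
    profile s t ^ 14 = (s + t) * max (sectorForm s t) 0 ^ 3 := by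
  unfold profile
  rw [← Real.rpow_natCast, ← Real.rpow_mul (mul_nonneg (add_nonneg hs ht) (by positivity))]
  norm_num

lemma profile_eq_zero {s t : ℝ} (h : sectorForm s t ≤ 0) : profile s t = 0 := by
  unfold profile
  rw [max_eq_right h]
  norm_num

lemma profile_zero_left (t : ℝ) : profile 0 t = 0 :=
  profile_eq_zero (by unfold sectorForm; nlinarith [sq_nonneg t])

lemma profile_pos {s t : ℝ} (hs : 0 < s) (ht : 0 < t) (h : 0 < sectorForm s t) :
    0 < profile s t := by
  unfold profile
  rw [max_eq_left h.le]
  positivity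

lemma profile_self {s : ℝ} (hs : 0 ≤ s) : profile s s = √(2 * s) := by
  refine (pow_left_inj₀ (profile_nonneg hs hs) (Real.sqrt_nonneg _)
    (by norm_num : (14 : ℕ) ≠ 0)).1 ?_
  have h : sectorForm s s = 4 * s ^ 2 := by unfold sectorForm; ring
  rw [profile_pow hs hs, h, max_eq_left (by positivity), show 14 = 2 * 7 from rfl, pow_mul,
    Real.sq_sqrt (by positivity)]
  ring

/-- The partial derivative of `profile` with respect to its first variable. -/
def profileDeriv (s t : ℝ) : ℝ :=
  sectorForm s t ^ 2 * (17 * t ^ 2 + 18 * s * t - 7 * s ^ 2) / (14 * profile s t ^ 13)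

lemma profileDeriv_self {s : ℝ} (hs : 0 < s) : profileDeriv s s = (2 * √(2 * s))⁻¹ := by
  have h : sectorForm s s = 4 * s ^ 2 := by unfold sectorForm; ring
  have h2 : 0 < √(2 * s) := by positivity
  have h3 : √(2 * s) ^ 13 = 64 * s ^ 6 * √(2 * s) := by
    rw [show 13 = 2 * 6 + 1 from rfl, pow_succ, pow_mul, Real.sq_sqrt (by positivity)]
    ring
  unfold profileDeriv
  rw [profile_self hs.le, h, h3]
  field_simp
  ring

lemma hasStrictFDerivAt_profile {V : Type*} [NormedAddCommGroup V] [NormedSpace ℝ V]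
    {s t : V → ℝ} {s' t' : V →L[ℝ] ℝ} {y : V} (hs' : HasStrictFDerivAt s s' y)
    (ht' : HasStrictFDerivAt t t' y) (hs : 0 < s y) (ht : 0 < t y)
    (h : 0 < sectorForm (s y) (t y)) :
    HasStrictFDerivAt (fun z => profile (s z) (t z))
      (profileDeriv (s y) (t y) • s' + profileDeriv (t y) (s y) • t') y := by
  have hM : 0 < (s y + t y) * sectorForm (s y) (t y) ^ 3 := by positivity
  have hN : HasStrictFDerivAt (fun z => sectorForm (s z) (t z))
      ((6 * t y - 2 * s y) • s' + (6 * s y - 2 * t y) • t') y := by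
    have := (((hs'.const_mul 6).mul ht').sub (hs'.pow 2)).sub (ht'.pow 2)
    refine this.congr_fderiv ?_
    ext v
    simp
    ring
  have hM' := (hs'.add ht').mul (hN.pow 3)
  have hd := (Real.hasStrictDerivAt_rpow_const (p := 1 / 14) (Or.inl hM.ne')).comp_hasStrictFDerivAt
    y hM'
  have heq : (fun z => profile (s z) (t z)) =ᶠ[𝓝 y]
      fun z => ((s z + t z) * sectorForm (s z) (t z) ^ 3) ^ (1 / 14 : ℝ) := by
    filter_upwards [hN.continuousAt.eventually (lt_mem_nhds h)] with z hz
    unfold profile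
    rw [max_eq_left hz.le]
  refine (hd.congr_of_eventuallyEq heq.symm).congr_fderiv ?_
  have hg : 0 < profile (s y) (t y) := profile_pos hs ht h
  have hpow : profile (s y) (t y) ^ 14 = (s y + t y) * sectorForm (s y) (t y) ^ 3 := by
    rw [profile_pow hs.le ht.le, max_eq_left h.le]
  have hrp : ((s y + t y) * sectorForm (s y) (t y) ^ 3) ^ ((1 / 14 : ℝ) - 1) =
      (profile (s y) (t y) ^ 13)⁻¹ := by
    rw [Real.rpow_sub_one hM.ne', ← hpow, show (1 / 14 : ℝ) = ((14 : ℕ) : ℝ)⁻¹ by norm_num,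
      Real.pow_rpow_inv_natCast hg.le (by norm_num)]
    field_simp
  ext v
  simp only [Pi.add_apply, smul_apply, add_apply, smul_eq_mul, hrp, profileDeriv]
  rw [profile_comm (t y), sectorForm_comm (t y)]
  field_simp
  simp only [sectorForm]
  ring

lemma profile_sq_le {s t : ℝ} (hs : 0 < s) (ht : 0 < t) (h : 0 < sectorForm s t) :
    profile s t ^ 2 ≤ 2 * √(s * t) := by
  refine (pow_le_pow_iff_left₀ (by positivity) (by positivity) (by norm_num : (14 : ℕ) ≠ 0)).1 ?_
  have h1 : (profile s t ^ 2) ^ 14 = ((s + t) * sectorForm s t ^ 3) ^ 2 := by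
    rw [← pow_mul, mul_comm, pow_mul, profile_pow hs.le ht.le, max_eq_left h.le]
  have h2 : (2 * √(s * t)) ^ 14 = 2 ^ 14 * (s * t) ^ 7 := by
    rw [mul_pow, show √(s * t) ^ 14 = (√(s * t) ^ 2) ^ 7 by ring, Real.sq_sqrt (by positivity)]
  rw [h1, h2]
  set p := s * t with hp
  set D := (s - t) ^ 2 with hD
  have hp0 : 0 < p := by positivity
  have hD0 : 0 ≤ D := by positivity
  have e1 : sectorForm s t = 4 * p - D := by simp only [sectorForm, hp, hD]; ring
  have e2 : (s + t) ^ 2 = 4 * p + D := by simp only [hp, hD]; ring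
  rw [e1] at h ⊢
  rw [mul_pow, e2]
  have e3 : (4 * p + D) * (4 * p - D) ≤ (4 * p) ^ 2 := by nlinarith [sq_nonneg D]
  calc (4 * p + D) * ((4 * p - D) ^ 3) ^ 2
      = ((4 * p + D) * (4 * p - D)) * (4 * p - D) ^ 5 := by ring
    _ ≤ (4 * p) ^ 2 * (4 * p) ^ 5 := by
        gcongr
        linarith
    _ = _ := by ring

lemma jacobian_poly_le {s t : ℝ} (hs : 0 < s) (ht : 0 < t) :
    sectorForm s t * (s * (17 * t ^ 2 + 18 * s * t - 7 * s ^ 2) ^ 2 +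
      t * (17 * s ^ 2 + 18 * t * s - 7 * t ^ 2) ^ 2) ≤ 3136 * (s * t) ^ 3 * (s + t) := by
  have key : 3136 * (s * t) ^ 3 * (s + t) - sectorForm s t * (s * (17 * t ^ 2 + 18 * s * t -
      7 * s ^ 2) ^ 2 + t * (17 * s ^ 2 + 18 * t * s - 7 * t ^ 2) ^ 2) =
      (s + t) * (s - t) ^ 2 * ((7 * (s + t) ^ 2 - 202 / 7 * (s * t)) ^ 2 +
        2316 / 49 * (s * t) ^ 2) := by
    unfold sectorForm
    ring
  have : 0 ≤ (s + t) * (s - t) ^ 2 * ((7 * (s + t) ^ 2 - 202 / 7 * (s * t)) ^ 2 +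
        2316 / 49 * (s * t) ^ 2) := by positivity
  linarith

/-- The Jacobian of the retraction along the cone is at most one. -/
lemma four_mul_profileDeriv_sq_le {s t : ℝ} (hs : 0 < s) (ht : 0 < t) (h : 0 < sectorForm s t)
    {n : ℕ} (hn : 3 ≤ n) :
    4 * (s * profileDeriv s t ^ 2 + t * profileDeriv t s ^ 2) *
      ((profile s t ^ 2 / (2 * √(s * t))) ^ n) ^ 2 ≤ 1 := by
  have hg : 0 < profile s t := profile_pos hs ht h
  have hr : 0 < √(s * t) := by positivity
  set q := profile s t ^ 2 / (2 * √(s * t)) with hq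
  have hq0 : 0 ≤ q := by positivity
  have hq1 : q ≤ 1 := (div_le_one (by positivity)).2 (profile_sq_le hs ht h)
  have hqn : (q ^ n) ^ 2 ≤ (q ^ 3) ^ 2 :=
    pow_le_pow_left₀ (by positivity) (pow_le_pow_of_le_one hq0 hq1 hn) 2
  refine (mul_le_mul_of_nonneg_left hqn (by positivity)).trans ?_
  have hq6 : (q ^ 3) ^ 2 = profile s t ^ 12 / (64 * (s * t) ^ 3) := by
    rw [hq, ← pow_mul, div_pow, ← pow_mul, mul_pow,
      show √(s * t) ^ (3 * 2) = (√(s * t) ^ 2) ^ 3 by ring, Real.sq_sqrt (by positivity)]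
    norm_num
  have hpow : profile s t ^ 14 = (s + t) * sectorForm s t ^ 3 := by
    rw [profile_pow hs.le ht.le, max_eq_left h.le]
  rw [hq6]
  unfold profileDeriv
  rw [profile_comm t, sectorForm_comm t, div_pow, div_pow, mul_pow 14, ← pow_mul,
    show profile s t ^ (13 * 2) = profile s t ^ 12 * profile s t ^ 14 by ring, hpow]
  have hp := jacobian_poly_le hs ht
  generalize profile s t = g at *
  generalize sectorForm s t = N at *
  generalize 17 * t ^ 2 + 18 * s * t - 7 * s ^ 2 = a at *
  generalize 17 * s ^ 2 + 18 * t * s - 7 * t ^ 2 = b at *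
  have e : 4 * (s * ((N ^ 2 * a) ^ 2 / (14 ^ 2 * (g ^ 12 * ((s + t) * N ^ 3)))) +
      t * ((N ^ 2 * b) ^ 2 / (14 ^ 2 * (g ^ 12 * ((s + t) * N ^ 3))))) *
      (g ^ 12 / (64 * (s * t) ^ 3)) = N * (s * a ^ 2 + t * b ^ 2) / (3136 * (s * t) ^ 3 * (s + t)) := by
    field_simp
    ring
  rw [e]
  exact (div_le_one (by positivity)).2 hp

end Profile

section Area

open Filter Topology

lemma hausdorffMeasure_image_le_of_edist_le {α X Y : Type*}
    [EMetricSpace X] [MeasurableSpace X] [BorelSpace X] [EMetricSpace Y] [MeasurableSpace Y]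
    [BorelSpace Y] {f : α → X} {G : α → Y} {A : Set α} {K : ℝ≥0}
    (h : ∀ a ∈ A, ∀ b ∈ A, edist (f a) (f b) ≤ K * edist (G a) (G b)) {d : ℝ} (hd : 0 ≤ d) :
    μH[d] (f '' A) ≤ (K : ENNReal) ^ d * μH[d] (G '' A) := by
  rcases A.eq_empty_or_nonempty with rfl | ⟨a₀, ha₀⟩
  · simp
  have : Nonempty α := ⟨a₀⟩
  have hmem : ∀ y ∈ G '' A, Function.invFunOn G A y ∈ A ∧ G (Function.invFunOn G A y) = y :=
    fun y hy => ⟨Function.invFunOn_mem hy, Function.invFunOn_eq hy⟩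
  have hlip : LipschitzOnWith K (f ∘ Function.invFunOn G A) (G '' A) := by
    intro x hx y hy
    have := h _ (hmem x hx).1 _ (hmem y hy).1
    rwa [(hmem x hx).2, (hmem y hy).2] at this
  have himg : (f ∘ Function.invFunOn G A) '' (G '' A) = f '' A := by
    rw [image_image]
    refine image_congr fun a ha => ?_
    have hG := hmem _ (mem_image_of_mem G ha)
    have := h _ hG.1 _ ha
    rw [hG.2, edist_self, mul_zero] at this
    exact edist_le_zero.1 this
  rw [← himg]
  exact hlip.hausdorffMeasure_image_le hd

lemma exists_one_lt_pow_le {c : ENNReal} (hc : 1 < c) (n : ℕ) :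
    ∃ K : ℝ≥0, 1 < K ∧ (K : ENNReal) ^ n ≤ c := by
  have hcont : Continuous fun K : ℝ≥0 => (K : ENNReal) ^ n := by fun_prop
  have ht : Tendsto (fun K : ℝ≥0 => (K : ENNReal) ^ n) (𝓝[>] 1) (𝓝 1) := by
    have := (hcont.tendsto 1).mono_left (nhdsWithin_le_nhds (s := Ioi 1))
    simpa using this
  obtain ⟨K, hK, h1⟩ := ((ht.eventually (gt_mem_nhds hc)).and self_mem_nhdsWithin).exists
  exact ⟨K, h1, hK.le⟩

/-- If `f` is, up to a factor close to one, controlled near `y` by `D ∘ Θ` where the derivative of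
`Θ` is a contraction and `D` is linear of determinant at most one, then `f` hardly increases the
Hausdorff measure near `y`. -/
lemma exists_nhds_hausdorffMeasure_image_le {V W X : Type*}
    [NormedAddCommGroup V] [NormedSpace ℝ V] [MeasurableSpace V] [BorelSpace V]
    [NormedAddCommGroup W] [MeasurableSpace W] [BorelSpace W]
    [NormedAddCommGroup X] [InnerProductSpace ℝ X] [FiniteDimensional ℝ X] [MeasurableSpace X]
    [BorelSpace X] {f : V → W} {Θ : V → X} {Q : V →L[ℝ] X} {y : V}
    (hΘ : HasStrictFDerivAt Θ Q y) (hQ : ‖Q‖ ≤ 1) {D : X →ₗ[ℝ] X} (hD : |LinearMap.det D| ≤ 1)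
    (htan : ∀ K : ℝ≥0, 1 < K →
      ∀ᶠ p : V × V in 𝓝 (y, y), ‖f p.1 - f p.2‖ ≤ K * ‖D (Θ p.1) - D (Θ p.2)‖)
    {c : ENNReal} (hc : 1 < c) :
    ∃ U ∈ 𝓝 y, ∀ A ⊆ U, μH[Module.finrank ℝ X] (f '' A) ≤ c * μH[Module.finrank ℝ X] A := by
  set d := Module.finrank ℝ X
  obtain ⟨K, hK, hKc⟩ := exists_one_lt_pow_le hc (2 * d)
  obtain ⟨U, hU, hlip⟩ := hΘ.exists_lipschitzOnWith_of_nnnorm_lt K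
    (lt_of_le_of_lt (by exact_mod_cast hQ) hK)
  have h := htan K hK
  rw [nhds_prod_eq, eventually_prod_self_iff'] at h
  obtain ⟨U', hU', h⟩ := h
  refine ⟨U ∩ U', inter_mem hU hU', fun A hA => ?_⟩
  have h1 : μH[d] (f '' A) ≤ (K : ENNReal) ^ (d : ℝ) * μH[d] ((fun x => D (Θ x)) '' A) := by
    refine hausdorffMeasure_image_le_of_edist_le (fun a ha b hb => ?_) (Nat.cast_nonneg _)
    have := h _ (hA ha).2 _ (hA hb).2
    rw [edist_eq_enorm_sub, edist_eq_enorm_sub, enorm_eq_nnnorm, enorm_eq_nnnorm]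
    exact_mod_cast this
  have h2 : μH[d] ((fun x => D (Θ x)) '' A) ≤ μH[d] (Θ '' A) := by
    rw [← image_image D Θ A, Measure.addHaar_image_linearMap]
    calc _ ≤ 1 * μH[d] (Θ '' A) := by
          gcongr
          exact ENNReal.ofReal_le_one.2 hD
      _ = _ := one_mul _
  have h3 : μH[d] (Θ '' A) ≤ (K : ENNReal) ^ (d : ℝ) * μH[d] A :=
    (hlip.mono fun a ha => (hA ha).1).hausdorffMeasure_image_le (Nat.cast_nonneg _)
  calc _ ≤ (K : ENNReal) ^ (d : ℝ) * ((K : ENNReal) ^ (d : ℝ) * μH[d] A) :=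
        h1.trans (by gcongr; exact h2.trans h3)
    _ = (K : ENNReal) ^ (2 * d) * μH[d] A := by
        rw [← mul_assoc, ENNReal.rpow_natCast, ← pow_add, two_mul]
    _ ≤ _ := by gcongr

lemma measure_image_le_of_locally {X Y : Type*} [TopologicalSpace X] [SecondCountableTopology X]
    [MeasurableSpace X] [BorelSpace X] [MeasurableSpace Y] {μ : Measure X}
    {ν : Measure Y} {f : X → Y} {Ω : Set X}
    (h : ∀ y ∈ Ω, ∀ c : ENNReal, 1 < c → ∃ U ∈ 𝓝 y, ∀ A ⊆ U, ν (f '' A) ≤ c * μ A)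
    {A : Set X} (hA : A ⊆ Ω) : ν (f '' A) ≤ μ A := by
  have key : ∀ c : ENNReal, 1 < c → ν (f '' A) ≤ c * μ A := by
    intro c hc
    choose! U hU hUA using fun y hy => h y hy c hc
    obtain ⟨t, htΩ, ht, hcov⟩ := TopologicalSpace.countable_cover_nhdsWithin
      (f := fun y => interior (U y)) (s := A) fun y hy =>
        mem_nhdsWithin_of_mem_nhds (interior_mem_nhds.2 (hU y (hA hy)))
    rcases t.eq_empty_or_nonempty with rfl | hne
    · have : A = ∅ := by simpa using hcov
      simp [this]
    obtain ⟨e, rfl⟩ := ht.exists_eq_range hne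
    let B : ℕ → Set X := disjointed fun n => interior (U (e n))
    have hB : ∀ n, MeasurableSet (B n) :=
      MeasurableSet.disjointed fun n => isOpen_interior.measurableSet
    have hAB : A = ⋃ n, B n ∩ A := by
      rw [← iUnion_inter, iUnion_disjointed, eq_comm, inter_eq_right]
      simpa using hcov
    have hsum : μ A = ∑' n, μ (B n ∩ A) := by
      have h1 := measure_iUnion (μ := μ.restrict A) (f := B) (disjoint_disjointed _) hB
      simp only [Measure.restrict_apply (hB _)] at h1
      rw [Measure.restrict_apply (MeasurableSet.iUnion hB), iUnion_inter] at h1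
      rw [← h1]
      exact congrArg μ hAB
    calc ν (f '' A) = ν (⋃ n, f '' (B n ∩ A)) := by rw [← image_iUnion, ← hAB]
      _ ≤ ∑' n, ν (f '' (B n ∩ A)) := measure_iUnion_le _
      _ ≤ ∑' n, c * μ (B n ∩ A) := ENNReal.tsum_le_tsum fun n =>
          hUA _ (hA (htΩ (mem_range_self n))) _ fun x hx =>
            interior_subset (disjointed_subset _ n hx.1)
      _ = c * μ A := by rw [ENNReal.tsum_mul_left, hsum]
  have ht : Tendsto (fun c : ENNReal => c * μ A) (𝓝[>] 1) (𝓝 (1 * μ A)) :=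
    ENNReal.Tendsto.mul_const (tendsto_id.mono_left nhdsWithin_le_nhds) (Or.inl one_ne_zero)
  rw [← one_mul (μ A)]
  have : (𝓝[>] (1 : ENNReal)).NeBot := nhdsGT_neBot_of_exists_gt ⟨2, by norm_num⟩
  exact ge_of_tendsto ht (eventually_mem_nhdsWithin.mono fun c hc => key c hc)

end Area

/-- An orthogonal decomposition of a Euclidean space, given by its orthogonal projections. -/
structure OrthoSplitting (ι V : Type*) [Fintype ι] [NormedAddCommGroup V]
    [InnerProductSpace ℝ V] where
  /-- The projections. -/
  proj : ι → V →L[ℝ] V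
  sum_proj : ∀ z, ∑ i, proj i z = z
  inner_proj_proj : ∀ i j, i ≠ j → ∀ x y, inner ℝ (proj i x) (proj j y) = 0

namespace OrthoSplitting

section Basic

variable {ι V : Type*} [Fintype ι] [NormedAddCommGroup V] [InnerProductSpace ℝ V]
  (S : OrthoSplitting ι V)

lemma proj_proj_of_ne {i j : ι} (h : i ≠ j) (x : V) : S.proj i (S.proj j x) = 0 := by
  have h1 : inner ℝ (S.proj i (S.proj j x)) (S.proj j x) =
      ∑ l, inner ℝ (S.proj i (S.proj j x)) (S.proj l (S.proj j x)) := by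
    rw [← inner_sum, S.sum_proj]
  rw [S.inner_proj_proj i j h, Finset.sum_eq_single i
    (fun l _ hl => S.inner_proj_proj i l hl.symm _ _) (by simp)] at h1
  exact inner_self_eq_zero.1 h1.symm

lemma proj_proj_self (i : ι) (x : V) : S.proj i (S.proj i x) = S.proj i x := by
  conv_rhs => rw [← S.sum_proj (S.proj i x)]
  rw [Finset.sum_eq_single i (fun l _ hl => S.proj_proj_of_ne hl x) (by simp)]

lemma inner_proj_left (i : ι) (x y : V) :
    inner ℝ (S.proj i x) y = inner ℝ (S.proj i x) (S.proj i y) := by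
  conv_lhs => rw [← S.sum_proj y]
  rw [inner_sum, Finset.sum_eq_single i (fun l _ hl => S.inner_proj_proj i l hl.symm _ _) (by simp)]

lemma inner_proj_right (i : ι) (x y : V) :
    inner ℝ x (S.proj i y) = inner ℝ (S.proj i x) (S.proj i y) := by
  simpa only [real_inner_comm] using S.inner_proj_left i y x

lemma inner_proj_comm (i : ι) (x y : V) :
    inner ℝ (S.proj i x) y = inner ℝ x (S.proj i y) :=
  (S.inner_proj_left i x y).trans (S.inner_proj_right i x y).symm

lemma sum_norm_proj_sq (x : V) : ∑ i, ‖S.proj i x‖ ^ 2 = ‖x‖ ^ 2 := by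
  conv_rhs => rw [← real_inner_self_eq_norm_sq, ← S.sum_proj x, sum_inner]
  refine Finset.sum_congr rfl fun i _ => ?_
  rw [S.sum_proj, inner_proj_left, real_inner_self_eq_norm_sq]

lemma ext_proj {x y : V} (h : ∀ i, S.proj i x = S.proj i y) : x = y := by
  rw [← S.sum_proj x, ← S.sum_proj y]
  exact Finset.sum_congr rfl fun i _ => h i

lemma norm_proj_le (i : ι) (x : V) : ‖S.proj i x‖ ≤ ‖x‖ := by
  refine (pow_le_pow_iff_left₀ (norm_nonneg _) (norm_nonneg _) two_ne_zero).1 ?_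
  rw [← S.sum_norm_proj_sq x]
  exact Finset.single_le_sum (f := fun i => ‖S.proj i x‖ ^ 2) (fun _ _ => by positivity)
    (Finset.mem_univ i)

lemma exists_frame [FiniteDimensional ℝ V] (i : ι) {n : ℕ}
    (hn : Module.finrank ℝ (LinearMap.range (S.proj i : V →ₗ[ℝ] V)) = n + 1) {y : V}
    (hy : S.proj i y ≠ 0) :
    ∃ b : Fin n → V, (∀ j, S.proj i (b j) = b j) ∧ (∀ j, inner ℝ (b j) y = 0) ∧
      ∀ v, inner ℝ (‖S.proj i y‖⁻¹ • S.proj i y) v ^ 2 + ∑ j, inner ℝ (b j) v ^ 2 =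
        ‖S.proj i v‖ ^ 2 := by
  set W := LinearMap.range (S.proj i : V →ₗ[ℝ] V)
  have hfix : ∀ w : W, S.proj i w = w := by
    rintro ⟨_, x, rfl⟩
    exact S.proj_proj_self i x
  let e : W := ⟨‖S.proj i y‖⁻¹ • S.proj i y, ‖S.proj i y‖⁻¹ • y, by simp⟩
  have hy0 : 0 < ‖S.proj i y‖ := norm_pos_iff.2 hy
  have he : ‖e‖ = 1 := by
    change ‖‖S.proj i y‖⁻¹ • S.proj i y‖ = 1
    rw [norm_smul, norm_inv, norm_norm, inv_mul_cancel₀ hy0.ne']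
  have horth : Orthonormal ℝ (({0} : Set (Fin (n + 1))).domRestrict fun _ => e) := by
    refine ⟨fun _ => he, fun a b hab => absurd ?_ hab⟩
    exact Subtype.ext (a.2.trans b.2.symm)
  obtain ⟨b, hb⟩ := horth.exists_orthonormalBasis_extension_of_card_eq (by simpa using hn)
  have hb0 : b 0 = e := hb 0 rfl
  refine ⟨fun j => b j.succ, fun j => hfix _, fun j => ?_, fun v => ?_⟩
  · have h1 : inner ℝ (b j.succ) (b 0) = 0 := b.orthonormal.2 (Fin.succ_ne_zero j)
    rw [hb0, Submodule.coe_inner] at h1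
    change inner ℝ (b j.succ : V) (‖S.proj i y‖⁻¹ • S.proj i y) = 0 at h1
    rw [inner_smul_right, mul_eq_zero, or_iff_right (inv_ne_zero hy0.ne')] at h1
    rwa [← S.inner_proj_comm, hfix] at h1
  · have h1 := b.sum_sq_norm_inner_right ⟨S.proj i v, v, rfl⟩
    rw [Fin.sum_univ_succ, hb0] at h1
    have h2 : ∀ w : W, inner ℝ (w : V) v = inner ℝ w (⟨S.proj i v, v, rfl⟩ : W) := by
      intro w
      rw [Submodule.coe_inner, ← S.inner_proj_comm, hfix]
    change inner ℝ (e : V) v ^ 2 + _ = _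
    rw [h2 e]
    simp_rw [h2]
    simpa using h1

end Basic

section Cone

variable {κ V : Type*} [Fintype κ] [NormedAddCommGroup V] [InnerProductSpace ℝ V]
  (S : OrthoSplitting (κ × Bool) V)

/-- The product of the cones `‖x‖ = ‖y‖` determined by a splitting into pairs of components. -/
def cone : Set V := {z | ∀ k, ‖S.proj (k, true) z‖ = ‖S.proj (k, false) z‖}

/-- The points of the cone all of whose components are nonzero. -/
def regularCone : Set V := {z ∈ S.cone | ∀ i, S.proj i z ≠ 0}

/-- The open set on which the retraction onto the cone is nondegenerate. -/
def sector : Set V :=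
  {z | ∀ k, 0 < sectorForm (‖S.proj (k, true) z‖ ^ 2) (‖S.proj (k, false) z‖ ^ 2)}

/-- `√2` times the norm of the `i`-th component of the retraction onto the cone. -/
def height (i : κ × Bool) (z : V) : ℝ :=
  profile (‖S.proj i z‖ ^ 2) (‖S.proj (i.1, !i.2) z‖ ^ 2)

/-- The scaling factor of the `i`-th component in the retraction onto the cone. -/
def scale (i : κ × Bool) (z : V) : ℝ := S.height i z / (√2 * ‖S.proj i z‖)

/-- An area-nonincreasing retraction onto the cone. -/
def retract (z : V) : V := ∑ i, S.scale i z • S.proj i z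

lemma isClosed_cone : IsClosed S.cone := by
  simp only [cone, ofPred_forall]
  exact isClosed_iInter fun k => isClosed_eq (by fun_prop) (by fun_prop)

lemma mem_cone_iff {z : V} : z ∈ S.cone ↔ ∀ i : κ × Bool, ‖S.proj i z‖ = ‖S.proj (i.1, !i.2) z‖ := by
  refine ⟨fun h => ?_, fun h k => h (k, true)⟩
  rintro ⟨k, _ | _⟩
  · exact (h k).symm
  · exact h k

lemma mem_sector_iff {z : V} : z ∈ S.sector ↔ ∀ i : κ × Bool,
    0 < sectorForm (‖S.proj i z‖ ^ 2) (‖S.proj (i.1, !i.2) z‖ ^ 2) := by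
  refine ⟨fun h => ?_, fun h k => h (k, true)⟩
  rintro ⟨k, _ | _⟩
  · rw [sectorForm_comm]; exact h k
  · exact h k

lemma height_nonneg (i : κ × Bool) (z : V) : 0 ≤ S.height i z :=
  profile_nonneg (by positivity) (by positivity)

lemma height_swap (i : κ × Bool) (z : V) : S.height (i.1, !i.2) z = S.height i z := by
  simp only [height, Bool.not_not]
  rw [profile_comm]

lemma continuous_height (i : κ × Bool) : Continuous (S.height i) :=
  continuous_profile.comp
    (f := fun z => (‖S.proj i z‖ ^ 2, ‖S.proj (i.1, !i.2) z‖ ^ 2)) (by fun_prop)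

lemma height_eq_zero {i : κ × Bool} {z : V} (h : S.proj i z = 0) : S.height i z = 0 := by
  rw [height, h, norm_zero, zero_pow two_ne_zero, profile_zero_left]

lemma proj_retract (i : κ × Bool) (z : V) : S.proj i (S.retract z) = S.scale i z • S.proj i z := by
  classical
  rw [retract, map_sum, Finset.sum_eq_single i]
  · rw [map_smul, proj_proj_self]
  · intro j _ hj
    rw [map_smul, proj_proj_of_ne _ hj.symm, smul_zero]
  · simp

lemma norm_scale_smul_proj (i : κ × Bool) (z : V) :
    ‖S.scale i z • S.proj i z‖ = S.height i z / √2 := by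
  rcases eq_or_ne (S.proj i z) 0 with h | h
  · rw [h, smul_zero, norm_zero, S.height_eq_zero h, zero_div]
  · have : 0 < ‖S.proj i z‖ := norm_pos_iff.2 h
    rw [norm_smul, scale, Real.norm_of_nonneg (div_nonneg (S.height_nonneg i z) (by positivity))]
    field_simp

lemma norm_proj_retract (i : κ × Bool) (z : V) :
    ‖S.proj i (S.retract z)‖ = S.height i z / √2 := by
  rw [proj_retract, norm_scale_smul_proj]

lemma retract_mem_cone (z : V) : S.retract z ∈ S.cone := fun k => by
  rw [norm_proj_retract, norm_proj_retract, ← S.height_swap (k, true)]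
  rfl

lemma scale_eq_one {z : V} (hz : z ∈ S.cone) {i : κ × Bool} (h : S.proj i z ≠ 0) :
    S.scale i z = 1 := by
  have : 0 < ‖S.proj i z‖ := norm_pos_iff.2 h
  rw [scale, height, ← S.mem_cone_iff.1 hz i, profile_self (by positivity),
    Real.sqrt_mul (by norm_num), Real.sqrt_sq this.le]
  exact div_self (by positivity)

lemma retract_eq_self {z : V} (hz : z ∈ S.cone) : S.retract z = z := by
  refine S.ext_proj fun i => ?_
  rw [proj_retract]
  rcases eq_or_ne (S.proj i z) 0 with h | h
  · rw [h, smul_zero]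
  · rw [S.scale_eq_one hz h, one_smul]

lemma continuous_retract : Continuous S.retract := by
  refine continuous_finsetSum _ fun i _ => continuous_iff_continuousAt.2 fun y => ?_
  rcases eq_or_ne (S.proj i y) 0 with h | h
  · have h1 : Filter.Tendsto (fun z => S.height i z / √2) (nhds y) (nhds 0) := by
      have := ((S.continuous_height i).div_const √2).tendsto y
      rwa [S.height_eq_zero h, zero_div] at this
    rw [ContinuousAt, h, smul_zero]
    exact squeeze_zero_norm (fun z => (S.norm_scale_smul_proj i z).le) h1
  · have : √2 * ‖S.proj i y‖ ≠ 0 := mul_ne_zero (by positivity) (norm_ne_zero_iff.2 h)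
    refine ContinuousAt.smul ?_ (S.proj i).continuous.continuousAt
    exact (S.continuous_height i).continuousAt.div (by fun_prop) this

lemma proj_ne_zero_of_mem_sector {z : V} (hz : z ∈ S.sector) (i : κ × Bool) : S.proj i z ≠ 0 := by
  have := pos_of_sectorForm_pos (by positivity) (S.mem_sector_iff.1 hz i)
  intro h
  simp [h] at this

lemma regularCone_subset_sector : S.regularCone ⊆ S.sector := by
  rintro z ⟨hz, h⟩
  refine S.mem_sector_iff.2 fun i => ?_
  have : 0 < ‖S.proj i z‖ := norm_pos_iff.2 (h i)
  rw [← S.mem_cone_iff.1 hz i, show sectorForm (‖S.proj i z‖ ^ 2) (‖S.proj i z‖ ^ 2) =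
    4 * (‖S.proj i z‖ ^ 2) ^ 2 by unfold sectorForm; ring]
  positivity

lemma mem_sector_of_retract_mem {z : V} (hz : S.retract z ∈ S.regularCone) : z ∈ S.sector := by
  refine S.mem_sector_iff.2 fun i => ?_
  by_contra! h
  have h1 := hz.2 i
  rw [← norm_ne_zero_iff, norm_proj_retract, height, profile_eq_zero h, zero_div] at h1
  exact h1 rfl

end Cone

end OrthoSplitting

namespace OrthoSplitting

section RetractArea

open Filter Topology

variable {κ V : Type*} [Fintype κ] [NormedAddCommGroup V] [InnerProductSpace ℝ V]
  (S : OrthoSplitting (κ × Bool) V)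

lemma inner_retract {i : κ × Bool} {b : V} (hb : S.proj i b = b) (z : V) :
    inner ℝ b (S.retract z) = S.scale i z * inner ℝ b z := by
  rw [← hb, S.inner_proj_left, S.proj_retract, inner_smul_right, ← S.inner_proj_left]

/-- The gradient at `y` of the height of the pair of components containing `i`. -/
def heightGrad (i : κ × Bool) (y : V) : V :=
  (2 * profileDeriv (‖S.proj i y‖ ^ 2) (‖S.proj (i.1, !i.2) y‖ ^ 2)) • S.proj i y +
    (2 * profileDeriv (‖S.proj (i.1, !i.2) y‖ ^ 2) (‖S.proj i y‖ ^ 2)) • S.proj (i.1, !i.2) y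

lemma heightGrad_swap (i : κ × Bool) (y : V) : S.heightGrad (i.1, !i.2) y = S.heightGrad i y := by
  simp only [heightGrad, Bool.not_not]
  rw [add_comm]

lemma hasStrictFDerivAt_norm_proj_sq (i : κ × Bool) (y : V) :
    HasStrictFDerivAt (fun z => ‖S.proj i z‖ ^ 2) (innerSL ℝ ((2 : ℝ) • S.proj i y)) y := by
  refine ((hasStrictFDerivAt_norm_sq (S.proj i y)).comp y
    (S.proj i).hasStrictFDerivAt).congr_fderiv ?_
  ext v
  simp [← S.inner_proj_left]

lemma hasStrictFDerivAt_height {y : V} (hy : y ∈ S.sector) (i : κ × Bool) :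
    HasStrictFDerivAt (S.height i) (innerSL ℝ (S.heightGrad i y)) y := by
  have hp : ∀ j, 0 < ‖S.proj j y‖ ^ 2 := fun j =>
    pow_pos (norm_pos_iff.2 (S.proj_ne_zero_of_mem_sector hy j)) 2
  refine (hasStrictFDerivAt_profile (S.hasStrictFDerivAt_norm_proj_sq i y)
    (S.hasStrictFDerivAt_norm_proj_sq (i.1, !i.2) y) (hp _) (hp _)
    (S.mem_sector_iff.1 hy i)).congr_fderiv ?_
  ext v
  simp [heightGrad]
  ring

lemma exists_hasStrictFDerivAt_inv_norm_proj {i : κ × Bool} {y : V} (hy : S.proj i y ≠ 0) :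
    ∃ L : V →L[ℝ] ℝ, HasStrictFDerivAt (fun z => ‖S.proj i z‖⁻¹) L y := by
  have h : ContDiffAt ℝ 1 (fun z => ‖S.proj i z‖⁻¹) y :=
    ((S.proj i).contDiff.contDiffAt.norm ℝ hy).inv (norm_ne_zero_iff.2 hy)
  exact ⟨_, h.hasStrictFDerivAt one_ne_zero⟩

lemma hasStrictFDerivAt_inner_retract {i : κ × Bool} {b y : V} (hb : S.proj i b = b)
    (hby : inner ℝ b y = 0) (hy : y ∈ S.sector) :
    HasStrictFDerivAt (fun z => inner ℝ b (S.retract z)) (S.scale i y • innerSL ℝ b) y := by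
  obtain ⟨L, hL⟩ :=
    S.exists_hasStrictFDerivAt_inv_norm_proj (S.proj_ne_zero_of_mem_sector hy i)
  have h1 := (((S.hasStrictFDerivAt_height hy i).mul_const (√2)⁻¹).mul hL).mul
    (innerSL ℝ b).hasStrictFDerivAt
  refine (h1.congr_of_eventuallyEq (Eventually.of_forall fun z => ?_)).congr_fderiv ?_
  · simp only [S.inner_retract hb, scale, Pi.mul_apply, innerSL_apply_apply]
    rw [div_eq_mul_inv, mul_inv, mul_assoc (S.height i z)]
  · ext v
    simp [hby, scale]
    left
    field_simp

lemma hasStrictFDerivAt_inner_unit_retract {i : κ × Bool} {y : V} (hy : y ∈ S.sector) :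
    HasStrictFDerivAt (fun z => inner ℝ (‖S.proj i y‖⁻¹ • S.proj i y) (S.retract z))
      ((√2)⁻¹ • innerSL ℝ (S.heightGrad i y)) y := by
  set e := ‖S.proj i y‖⁻¹ • S.proj i y with he
  have hy0 : 0 < ‖S.proj i y‖ := norm_pos_iff.2 (S.proj_ne_zero_of_mem_sector hy i)
  have hPe : S.proj i e = e := by rw [he, map_smul, proj_proj_self]
  have hne : ‖e‖ = 1 := by rw [he, norm_smul, norm_inv, norm_norm, inv_mul_cancel₀ hy0.ne']
  obtain ⟨L, hL⟩ :=
    S.exists_hasStrictFDerivAt_inv_norm_proj (S.proj_ne_zero_of_mem_sector hy i)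
  have hu := hL.mul (innerSL ℝ e).hasStrictFDerivAt
  have huy : ‖S.proj i y‖⁻¹ * inner ℝ e y = 1 := by
    rw [he, inner_smul_left, S.inner_proj_left, real_inner_self_eq_norm_sq]
    simp
    field_simp
  have hmax : IsLocalMax ((fun z => ‖S.proj i z‖⁻¹) * ⇑(innerSL ℝ e)) y := by
    refine Eventually.of_forall fun z => ?_
    simp only [Pi.mul_apply, innerSL_apply_apply, huy]
    have h1 : inner ℝ e z ≤ ‖S.proj i z‖ := by
      rw [← hPe, S.inner_proj_left, hPe]
      simpa [hne] using real_inner_le_norm e (S.proj i z)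
    rw [inv_mul_eq_div]
    exact div_le_one_of_le₀ h1 (norm_nonneg _)
  have h0 := hmax.hasFDerivAt_eq_zero hu.hasFDerivAt
  rw [h0] at hu
  have h1 := ((S.hasStrictFDerivAt_height hy i).mul_const (√2)⁻¹).mul hu
  refine (h1.congr_of_eventuallyEq (Eventually.of_forall fun z => ?_)).congr_fderiv ?_
  · simp only [S.inner_retract hPe, scale, Pi.mul_apply, innerSL_apply_apply]
    rw [div_eq_mul_inv, mul_inv, ← mul_assoc, ← mul_assoc]
  · ext v
    simp [huy]

lemma abs_inner_sub_le_of_mem_cone {e e' : V} (he : e ∈ S.cone) (he' : e' ∈ S.cone) (p : V)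
    (k : κ) :
    |inner ℝ (S.proj (k, true) p - S.proj (k, false) p) (e - e')| ≤
      ‖(2 : ℝ) • p - (e + e')‖ * ‖e - e'‖ := by
  have h1 : ∀ i, inner ℝ (S.proj i (e + e')) (e - e') = ‖S.proj i e‖ ^ 2 - ‖S.proj i e'‖ ^ 2 := by
    intro i
    rw [S.inner_proj_left, map_add, map_sub, inner_add_left, inner_sub_right, inner_sub_right,
      real_inner_self_eq_norm_sq, real_inner_self_eq_norm_sq, real_inner_comm (S.proj i e')]
    ring
  set u := (2 : ℝ) • p - (e + e') with hu
  have h2 : 2 * inner ℝ (S.proj (k, true) p - S.proj (k, false) p) (e - e') =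
      inner ℝ (S.proj (k, true) u - S.proj (k, false) u) (e - e') := by
    have h3 := h1 (k, true)
    rw [he k, he' k, ← h1] at h3
    rw [hu, map_sub, map_sub, map_smul, map_smul]
    simp only [inner_sub_left, inner_smul_left, conj_trivial]
    linarith
  have h4 : |inner ℝ (S.proj (k, true) u - S.proj (k, false) u) (e - e')| ≤
      (2 * ‖u‖) * ‖e - e'‖ := by
    refine (abs_real_inner_le_norm _ _).trans ?_
    gcongr
    refine (norm_sub_le _ _).trans ?_
    linarith [S.norm_proj_le (k, true) u, S.norm_proj_le (k, false) u]
  rw [← h2, abs_mul, abs_two] at h4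
  linarith

lemma scale_pos {y : V} (hy : y ∈ S.sector) (i : κ × Bool) : 0 < S.scale i y := by
  have hp : ∀ j, 0 < ‖S.proj j y‖ := fun j =>
    norm_pos_iff.2 (S.proj_ne_zero_of_mem_sector hy j)
  have := profile_pos (pow_pos (hp i) 2) (pow_pos (hp (i.1, !i.2)) 2) (S.mem_sector_iff.1 hy i)
  exact div_pos this (mul_pos (by positivity) (hp i))

lemma inner_heightGrad_sq_le {y : V} (hy : y ∈ S.sector) {n : ℕ} (hn : 3 ≤ n) (k : κ) (v : V) :
    ((S.scale (k, true) y * S.scale (k, false) y) ^ n * inner ℝ (S.heightGrad (k, true) y) v) ^ 2 ≤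
      inner ℝ (‖S.proj (k, true) y‖⁻¹ • S.proj (k, true) y) v ^ 2 +
        inner ℝ (‖S.proj (k, false) y‖⁻¹ • S.proj (k, false) y) v ^ 2 := by
  have hp : ∀ j, 0 < ‖S.proj j y‖ := fun j =>
    norm_pos_iff.2 (S.proj_ne_zero_of_mem_sector hy j)
  have hs := hp (k, true)
  have ht := hp (k, false)
  have hJ := four_mul_profileDeriv_sq_le (pow_pos hs 2) (pow_pos ht 2) (hy k) hn
  have hq : S.scale (k, true) y * S.scale (k, false) y =
      profile (‖S.proj (k, true) y‖ ^ 2) (‖S.proj (k, false) y‖ ^ 2) ^ 2 /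
        (2 * √(‖S.proj (k, true) y‖ ^ 2 * ‖S.proj (k, false) y‖ ^ 2)) := by
    have h2 : √2 * √2 = 2 := Real.mul_self_sqrt (by norm_num)
    rw [← mul_pow, Real.sqrt_sq (by positivity)]
    simp only [scale, height, Bool.not_true, Bool.not_false]
    rw [profile_comm (‖S.proj (k, false) y‖ ^ 2), div_mul_div_comm, ← sq]
    congr 1
    linear_combination ‖S.proj (k, true) y‖ * ‖S.proj (k, false) y‖ * h2
  rw [← hq] at hJ
  generalize (S.scale (k, true) y * S.scale (k, false) y) ^ n = q at *
  simp only [heightGrad, Bool.not_true, inner_add_left, inner_smul_left]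
  generalize profileDeriv (‖S.proj (k, true) y‖ ^ 2) (‖S.proj (k, false) y‖ ^ 2) = a at *
  generalize profileDeriv (‖S.proj (k, false) y‖ ^ 2) (‖S.proj (k, true) y‖ ^ 2) = b at *
  generalize inner ℝ (S.proj (k, true) y) v = X at *
  generalize inner ℝ (S.proj (k, false) y) v = Y at *
  generalize ‖S.proj (k, true) y‖ = s at *
  generalize ‖S.proj (k, false) y‖ = t at *
  simp only [conj_trivial]
  obtain ⟨X, rfl⟩ : ∃ X', X = s * X' := ⟨s⁻¹ * X, by field_simp⟩
  obtain ⟨Y, rfl⟩ : ∃ Y', Y = t * Y' := ⟨t⁻¹ * Y, by field_simp⟩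
  rw [inv_mul_cancel_left₀ hs.ne', inv_mul_cancel_left₀ ht.ne']
  calc (q * (2 * a * (s * X) + 2 * b * (t * Y))) ^ 2
      = 4 * (s ^ 2 * a ^ 2 + t ^ 2 * b ^ 2) * q ^ 2 * (X ^ 2 + Y ^ 2) -
        4 * q ^ 2 * (s * a * Y - t * b * X) ^ 2 := by ring
    _ ≤ 4 * (s ^ 2 * a ^ 2 + t ^ 2 * b ^ 2) * q ^ 2 * (X ^ 2 + Y ^ 2) :=
        sub_le_self _ (by positivity)
    _ ≤ 1 * (X ^ 2 + Y ^ 2) := by gcongr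
    _ = _ := one_mul _

end RetractArea

end OrthoSplitting

lemma det_toEuclideanLin_diagonal {I : Type*} [Fintype I] [DecidableEq I] (lam : I → ℝ) :
    LinearMap.det (Matrix.toEuclideanLin (Matrix.diagonal lam)) = ∏ x, lam x := by
  rw [Matrix.toEuclideanLin_eq_toLin_orthonormal, LinearMap.det_toLin, Matrix.det_diagonal]

namespace OrthoSplitting

section RetractArea

open Filter Topology

variable {κ V : Type*} [Fintype κ] [NormedAddCommGroup V] [InnerProductSpace ℝ V]
  (S : OrthoSplitting (κ × Bool) V)

/-- The normal component of a small increment of the retraction is negligible. -/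
lemma eventually_abs_inner_sub_le {y : V} (hy : y ∈ S.sector) (k : κ) {η : ℝ} (hη : 0 < η) :
    ∀ᶠ p : V × V in 𝓝 (y, y),
      |inner ℝ (‖S.proj (k, true) y‖⁻¹ • S.proj (k, true) y) (S.retract p.1 - S.retract p.2) -
        inner ℝ (‖S.proj (k, false) y‖⁻¹ • S.proj (k, false) y) (S.retract p.1 - S.retract p.2)| ≤
      η * ‖S.retract p.1 - S.retract p.2‖ := by
  set h := S.height (k, true) y / √2 with hh
  have hp : ∀ j, 0 < ‖S.proj j y‖ := fun j =>
    norm_pos_iff.2 (S.proj_ne_zero_of_mem_sector hy j)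
  have hh0 : 0 < h := by
    rw [hh, ← S.norm_scale_smul_proj, norm_smul]
    exact mul_pos (norm_pos_iff.2 (S.scale_pos hy _).ne') (hp _)
  have hproj : ∀ σ, S.proj (k, σ) (S.retract y) =
      h • (‖S.proj (k, σ) y‖⁻¹ • S.proj (k, σ) y) := by
    intro σ
    have : S.height (k, σ) y = S.height (k, true) y := by
      cases σ
      · exact S.height_swap (k, true) y
      · rfl
    rw [proj_retract, smul_smul, scale, this, hh]
    congr 1
    field_simp
  have hcont : Tendsto (fun p : V × V => ‖(2 : ℝ) • S.retract y - (S.retract p.1 + S.retract p.2)‖)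
      (𝓝 (y, y)) (𝓝 0) := by
    have hR := S.continuous_retract
    have : Continuous fun p : V × V =>
      ‖(2 : ℝ) • S.retract y - (S.retract p.1 + S.retract p.2)‖ := by fun_prop
    convert this.tendsto (y, y) using 2
    rw [two_smul, sub_self, norm_zero]
  filter_upwards [hcont.eventually (gt_mem_nhds (mul_pos hη hh0))] with p hp
  have h1 := S.abs_inner_sub_le_of_mem_cone (S.retract_mem_cone p.1) (S.retract_mem_cone p.2)
    (S.retract y) k
  rw [hproj, hproj, ← smul_sub, inner_smul_left, inner_sub_left, abs_mul] at h1
  simp only [conj_trivial, abs_of_pos hh0] at h1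
  have h2 := h1.trans (mul_le_mul_of_nonneg_right hp.le (norm_nonneg _))
  rw [mul_comm η, mul_assoc] at h2
  exact le_of_mul_le_mul_left h2 hh0

lemma exists_nhds_hausdorffMeasure_retract_le [FiniteDimensional ℝ V] [MeasurableSpace V]
    [BorelSpace V] {n : κ → ℕ}
    (hn : ∀ i : κ × Bool,
      Module.finrank ℝ (LinearMap.range (S.proj i : V →ₗ[ℝ] V)) = n i.1 + 1)
    (h3 : ∀ k, 3 ≤ n k) {y : V} (hy : y ∈ S.sector) {c : ENNReal} (hc : 1 < c) :
    ∃ U ∈ 𝓝 y, ∀ A ⊆ U, μH[(∑ k, (2 * n k + 1) : ℕ)] (S.retract '' A) ≤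
      c * μH[(∑ k, (2 * n k + 1) : ℕ)] A := by
  classical
  have hpr : ∀ i, S.proj i y ≠ 0 := S.proj_ne_zero_of_mem_sector hy
  choose b hPb hby hfr using fun i => S.exists_frame i (hn i) (hpr i)
  let e : κ × Bool → V := fun i => ‖S.proj i y‖⁻¹ • S.proj i y
  have hsum : ∀ v : V, (∑ i, ∑ j, inner ℝ (b i j) v ^ 2) +
      ∑ k, (inner ℝ (e (k, true)) v ^ 2 + inner ℝ (e (k, false)) v ^ 2) = ‖v‖ ^ 2 := by
    intro v
    have h1 : ∑ i, ‖S.proj i v‖ ^ 2 = ∑ i, inner ℝ (e i) v ^ 2 + ∑ i, ∑ j, inner ℝ (b i j) v ^ 2 := by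
      rw [← Finset.sum_add_distrib]
      exact Finset.sum_congr rfl fun i _ => (hfr i v).symm
    rw [← S.sum_norm_proj_sq v, h1, add_comm, Fintype.sum_prod_type (fun i => inner ℝ (e i) v ^ 2)]
    simp only [Fintype.sum_bool]
  let I : Type _ := (Σ i : κ × Bool, Fin (n i.1)) ⊕ κ
  let q : κ → ℝ := fun k => (S.scale (k, true) y * S.scale (k, false) y) ^ n k
  have hq : ∀ k, 0 < q k := fun k => pow_pos (mul_pos (S.scale_pos hy _) (S.scale_pos hy _)) _
  let lam : I → ℝ := Sum.elim (fun x => S.scale x.1 y) fun k => (q k)⁻¹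
  have hlam : ∀ x, lam x ≠ 0 := by
    rintro (x | k)
    · exact (S.scale_pos hy _).ne'
    · exact inv_ne_zero (hq k).ne'
  let B : I → V := Sum.elim (fun x => b x.1 x.2) fun k => (√2)⁻¹ • (e (k, true) + e (k, false))
  let g : I → V := Sum.elim (fun x => b x.1 x.2) fun k => q k • S.heightGrad (k, true) y
  let Q : V →L[ℝ] EuclideanSpace ℝ I :=
    (EuclideanSpace.equiv I ℝ).symm.toContinuousLinearMap ∘L
      ContinuousLinearMap.pi fun x => innerSL ℝ (g x)
  let Θ : V → EuclideanSpace ℝ I := fun z =>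
    WithLp.toLp 2 fun x => (lam x)⁻¹ * inner ℝ (B x) (S.retract z)
  have hΘ : HasStrictFDerivAt Θ Q y := by
    refine hasStrictFDerivAt_euclidean.2 ?_
    rintro (x | k)
    · refine ((S.hasStrictFDerivAt_inner_retract (hPb x.1 x.2) (hby x.1 x.2) hy).const_mul
        (lam (Sum.inl x))⁻¹).congr_fderiv ?_
      ext v
      change (S.scale x.1 y)⁻¹ * (S.scale x.1 y * inner ℝ (b x.1 x.2) v) = inner ℝ (b x.1 x.2) v
      exact inv_mul_cancel_left₀ (S.scale_pos hy _).ne' _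
    · have h1 := ((S.hasStrictFDerivAt_inner_unit_retract (i := (k, true)) hy).add
        (S.hasStrictFDerivAt_inner_unit_retract (i := (k, false)) hy)).const_mul
        ((lam (Sum.inr k))⁻¹ * (√2)⁻¹)
      refine (h1.congr_of_eventuallyEq (Eventually.of_forall fun z => ?_)).congr_fderiv ?_
      · change _ * (inner ℝ (e (k, true)) _ + inner ℝ (e (k, false)) _) =
          (lam (Sum.inr k))⁻¹ * inner ℝ ((√2)⁻¹ • (e (k, true) + e (k, false))) _
        rw [inner_smul_left (e (k, true) + e (k, false)), inner_add_left (e (k, true)), mul_assoc]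
        rfl
      · ext v
        change ((q k)⁻¹)⁻¹ * (√2)⁻¹ * ((√2)⁻¹ * inner ℝ (S.heightGrad (k, true) y) v +
          (√2)⁻¹ * inner ℝ (S.heightGrad (k, false) y) v) =
          inner ℝ (q k • S.heightGrad (k, true) y) v
        have h2 : √2 * √2 = 2 := Real.mul_self_sqrt (by norm_num)
        rw [show S.heightGrad (k, false) y = S.heightGrad (k, true) y from
          S.heightGrad_swap (k, true) y, inner_smul_left, inv_inv, conj_trivial]
        field_simp
        rw [sq, h2]
        ring
  have hQ : ‖Q‖ ≤ 1 := by
    refine Q.opNorm_le_bound zero_le_one fun v => ?_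
    refine (pow_le_pow_iff_left₀ (norm_nonneg _) (by positivity) two_ne_zero).1 ?_
    rw [one_mul, EuclideanSpace.norm_sq_eq, Fintype.sum_sum_type, Fintype.sum_sigma, ← hsum v]
    refine add_le_add (le_of_eq ?_) (Finset.sum_le_sum fun k _ => ?_)
    · refine Finset.sum_congr rfl fun i _ => Finset.sum_congr rfl fun j _ => ?_
      rw [Real.norm_eq_abs, sq_abs]
      rfl
    · rw [Real.norm_eq_abs, sq_abs]
      change inner ℝ (q k • S.heightGrad (k, true) y) v ^ 2 ≤ _
      rw [inner_smul_left]
      exact S.inner_heightGrad_sq_le hy (h3 k) k v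
  have hdet : |LinearMap.det (Matrix.toEuclideanLin (Matrix.diagonal lam))| ≤ 1 := by
    have : ∏ x, lam x = 1 := by
      rw [Fintype.prod_sum_type, Fintype.prod_sigma, Fintype.prod_prod_type,
        ← Finset.prod_mul_distrib]
      refine Finset.prod_eq_one fun k _ => ?_
      simp only [lam, Sum.elim_inl, Sum.elim_inr, Finset.prod_const, Finset.card_univ,
        Fintype.card_fin, Fintype.prod_bool, ← mul_pow]
      exact mul_inv_cancel₀ (hq k).ne'
    rw [det_toEuclideanLin_diagonal, this, abs_one]
  have hDΘ : ∀ z, Matrix.toEuclideanLin (Matrix.diagonal lam) (Θ z) =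
      WithLp.toLp 2 fun x => inner ℝ (B x) (S.retract z) := by
    intro z
    rw [Matrix.toEuclideanLin, Matrix.toLpLin_apply]
    congr 1
    ext x
    rw [Matrix.mulVec_diagonal]
    exact mul_inv_cancel_left₀ (hlam x) _
  have hB : ∀ w : V, ‖w‖ ^ 2 = (∑ x, inner ℝ (B x) w ^ 2) +
      ∑ k, (inner ℝ (e (k, true)) w - inner ℝ (e (k, false)) w) ^ 2 / 2 := by
    intro w
    rw [← hsum w, Fintype.sum_sum_type, Fintype.sum_sigma, add_assoc, ← Finset.sum_add_distrib]
    congr 1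
    refine Finset.sum_congr rfl fun k _ => ?_
    simp only [B, Sum.elim_inr, inner_smul_left, inner_add_left, conj_trivial, mul_pow, inv_pow]
    rw [Real.sq_sqrt (by norm_num)]
    ring
  have hcard : Module.finrank ℝ (EuclideanSpace ℝ I) = ∑ k, (2 * n k + 1) := by
    rw [finrank_euclideanSpace, Fintype.card_sum, Fintype.card_sigma]
    simp only [Fintype.card_fin]
    rw [Fintype.sum_prod_type, Finset.sum_add_distrib]
    simp [two_mul]
  rw [← hcard]
  refine exists_nhds_hausdorffMeasure_image_le hΘ hQ hdet (fun K hK => ?_) hc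
  have hK0 : (1 : ℝ) < K := by exact_mod_cast hK
  obtain ⟨η, hη, hηK⟩ : ∃ η : ℝ, 0 < η ∧ Fintype.card κ * (η ^ 2 / 2) ≤ 1 - ((K : ℝ) ^ 2)⁻¹ := by
    have hpos : 0 < 1 - ((K : ℝ) ^ 2)⁻¹ := sub_pos.2 (inv_lt_one_of_one_lt₀ (by nlinarith))
    refine ⟨√((1 - ((K : ℝ) ^ 2)⁻¹) / (Fintype.card κ + 1)), by positivity, ?_⟩
    rw [Real.sq_sqrt (by positivity)]
    generalize 1 - ((K : ℝ) ^ 2)⁻¹ = a at *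
    have : (Fintype.card κ : ℝ) * (a / (Fintype.card κ + 1)) ≤ a := by
      rw [mul_div_assoc', div_le_iff₀ (by positivity)]
      nlinarith
    have h0 : 0 ≤ (Fintype.card κ : ℝ) * (a / (Fintype.card κ + 1)) := by positivity
    linarith
  filter_upwards [eventually_all.2 fun k => S.eventually_abs_inner_sub_le hy k hη] with p hp
  rw [hDΘ, hDΘ]
  set w := S.retract p.1 - S.retract p.2 with hw
  have hnorm : ‖(WithLp.toLp 2 fun x => inner ℝ (B x) (S.retract p.1) : EuclideanSpace ℝ I) -
      WithLp.toLp 2 fun x => inner ℝ (B x) (S.retract p.2)‖ ^ 2 = ∑ x, inner ℝ (B x) w ^ 2 := by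
    rw [EuclideanSpace.norm_sq_eq]
    refine Finset.sum_congr rfl fun x _ => ?_
    rw [Real.norm_eq_abs, sq_abs, hw, inner_sub_right]
    rfl
  refine (pow_le_pow_iff_left₀ (norm_nonneg _) (by positivity) two_ne_zero).1 ?_
  rw [mul_pow, hnorm]
  have h4 : ∑ k, (inner ℝ (e (k, true)) w - inner ℝ (e (k, false)) w) ^ 2 / 2 ≤
      (1 - ((K : ℝ) ^ 2)⁻¹) * ‖w‖ ^ 2 := by
    calc _ ≤ ∑ _k : κ, η ^ 2 / 2 * ‖w‖ ^ 2 := by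
          refine Finset.sum_le_sum fun k _ => ?_
          have := pow_le_pow_left₀ (abs_nonneg _) (hp k) 2
          rw [sq_abs, mul_pow] at this
          change (inner ℝ (e (k, true)) w - inner ℝ (e (k, false)) w) ^ 2 ≤ _ at this
          linarith
      _ = Fintype.card κ * (η ^ 2 / 2) * ‖w‖ ^ 2 := by simp [mul_assoc]
      _ ≤ _ := by gcongr
  have h5 := hB w
  have h6 : ((K : ℝ) ^ 2)⁻¹ * ‖w‖ ^ 2 ≤ ∑ x, inner ℝ (B x) w ^ 2 := by linarith
  rwa [inv_mul_le_iff₀ (by positivity)] at h6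

/-- The retraction does not increase area. -/
lemma hausdorffMeasure_retract_le [FiniteDimensional ℝ V] [MeasurableSpace V]
    [BorelSpace V] {n : κ → ℕ}
    (hn : ∀ i : κ × Bool,
      Module.finrank ℝ (LinearMap.range (S.proj i : V →ₗ[ℝ] V)) = n i.1 + 1)
    (h3 : ∀ k, 3 ≤ n k) {A : Set V} (hA : A ⊆ S.sector) :
    μH[(∑ k, (2 * n k + 1) : ℕ)] (S.retract '' A) ≤ μH[(∑ k, (2 * n k + 1) : ℕ)] A :=
  measure_image_le_of_locally
    (fun _ hy _ hc => S.exists_nhds_hausdorffMeasure_retract_le hn h3 hy hc) hA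

end RetractArea

end OrthoSplitting

namespace OrthoSplitting

section Surjectivity

variable {κ V : Type*} [Fintype κ] [NormedAddCommGroup V] [InnerProductSpace ℝ V]
  (S : OrthoSplitting (κ × Bool) V)

/-- The difference of the two components of `p` in the `k`-th pair, a normal vector to the cone. -/
def conormal (p : V) (k : κ) : V := S.proj (k, true) p - S.proj (k, false) p

/-- The defining functions of the cone. -/
def defect (k : κ) (z : V) : ℝ := ‖S.proj (k, true) z‖ ^ 2 - ‖S.proj (k, false) z‖ ^ 2

lemma mem_cone_iff_defect {z : V} : z ∈ S.cone ↔ ∀ k, S.defect k z = 0 := by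
  refine forall_congr' fun k => ?_
  rw [defect, sub_eq_zero, pow_left_inj₀ (norm_nonneg _) (norm_nonneg _) two_ne_zero]

lemma continuous_defect (k : κ) : Continuous (S.defect k) := by
  unfold defect; fun_prop

lemma proj_sum_smul_conormal (p : V) (a : κ → ℝ) (k : κ) (σ : Bool) :
    S.proj (k, σ) (∑ j, a j • S.conormal p j) =
      (bif σ then a k else -a k) • S.proj (k, σ) p := by
  classical
  rw [map_sum, Finset.sum_eq_single k]
  · rw [map_smul, conormal, map_sub]
    cases σ
    · rw [proj_proj_self, proj_proj_of_ne _ (by simp)]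
      simp
    · rw [proj_proj_self, proj_proj_of_ne _ (by simp)]
      simp
  · intro j _ hj
    rw [map_smul, conormal, map_sub, proj_proj_of_ne _ (by simp [hj.symm]),
      proj_proj_of_ne _ (by simp [hj.symm]), sub_self, smul_zero]
  · simp

lemma eq_of_add_conormal_eq_zero {p w : V} (hp : p ∈ S.regularCone) (hw : w ∈ S.cone) {a : κ → ℝ}
    (h : w - p + ∑ k, a k • S.conormal p k = 0) : (∀ k, a k = 0) ∧ w = p := by
  have hw' : w = p - ∑ k, a k • S.conormal p k := by
    rw [eq_sub_iff_add_eq, ← sub_eq_zero, ← h]; abel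
  have ha : ∀ k, a k = 0 := by
    intro k
    have h1 := hw k
    rw [hw', map_sub, map_sub, proj_sum_smul_conormal, proj_sum_smul_conormal] at h1
    have h2 : ∀ (c : ℝ) (x : V), ‖x - c • x‖ = |1 - c| * ‖x‖ := by
      intro c x
      rw [← Real.norm_eq_abs, ← norm_smul, sub_smul, one_smul]
    rw [h2, h2, ← hp.1 k] at h1
    have h3 := mul_right_cancel₀ (norm_ne_zero_iff.2 (hp.2 (k, true))) h1
    simp only [cond_true, cond_false] at h3
    rcases abs_eq_abs.1 h3 with h4 | h4 <;> linarith
  refine ⟨ha, ?_⟩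
  rw [hw']
  simp [ha]

lemma hasFDerivAt_inv_norm_proj {i : κ × Bool} {p : V} (hp : S.proj i p ≠ 0) :
    HasFDerivAt (fun z => ‖S.proj i z‖⁻¹) (-((‖S.proj i p‖ ^ 3)⁻¹ • innerSL ℝ (S.proj i p))) p := by
  have hr : 0 < ‖S.proj i p‖ := norm_pos_iff.2 hp
  have h1 := (S.hasStrictFDerivAt_norm_proj_sq i p).hasFDerivAt
  have h2 := ((Real.hasDerivAt_sqrt (pow_ne_zero 2 hr.ne')).inv
    (by rw [Real.sqrt_sq hr.le]; exact hr.ne')).comp_hasFDerivAt p h1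
  refine (h2.congr_of_eventuallyEq (Filter.Eventually.of_forall fun z => ?_)).congr_fderiv ?_
  · simp
  · ext v
    simp only [Real.sqrt_sq hr.le]
    simp
    field_simp

lemma hasFDerivAt_scale {p : V} (hp : p ∈ S.regularCone) (i : κ × Bool) :
    HasFDerivAt (S.scale i) ((2 * ‖S.proj i p‖ ^ 2)⁻¹ •
      innerSL ℝ (S.proj (i.1, !i.2) p - S.proj i p)) p := by
  have hr : 0 < ‖S.proj i p‖ := norm_pos_iff.2 (hp.2 i)
  have hsw := S.mem_cone_iff.1 hp.1 i
  have hgrad : S.heightGrad i p =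
      (√2 * ‖S.proj i p‖)⁻¹ • (S.proj i p + S.proj (i.1, !i.2) p) := by
    rw [heightGrad, ← hsw, profileDeriv_self (pow_pos hr 2), Real.sqrt_mul (by norm_num),
      Real.sqrt_sq hr.le, smul_add]
    congr 2 <;> field_simp
  have hheight : S.height i p = √2 * ‖S.proj i p‖ := by
    rw [height, ← hsw, profile_self (by positivity), Real.sqrt_mul (by norm_num),
      Real.sqrt_sq hr.le]
  have h1 := ((S.hasStrictFDerivAt_height (S.regularCone_subset_sector hp) i).hasFDerivAt.mul_const
    (√2)⁻¹).mul (S.hasFDerivAt_inv_norm_proj (hp.2 i))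
  refine (h1.congr_of_eventuallyEq (Filter.Eventually.of_forall fun z => ?_)).congr_fderiv ?_
  · simp only [scale, Pi.mul_apply]
    rw [div_eq_mul_inv, mul_inv, mul_assoc]
  · ext v
    have h2 : √2 ^ 2 = 2 := Real.sq_sqrt (by norm_num)
    simp only [hgrad, hheight]
    simp
    field_simp
    rw [h2]
    ring

/-- The retraction onto the cone, perturbed in the normal directions so as to become a local
diffeomorphism at `p`. -/
def shear (p : V) (f : V → V) (z : V) : V :=
  S.retract (f z) - p + ∑ k, ((4 * ‖S.proj (k, true) p‖ ^ 2)⁻¹ * S.defect k z) • S.conormal p k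

lemma continuous_shear (p : V) {f : V → V} (hf : Continuous f) : Continuous (S.shear p f) := by
  have := S.continuous_retract
  have := S.continuous_defect
  unfold shear
  fun_prop

lemma mem_cone_of_shear_eq_zero {p : V} (hp : p ∈ S.regularCone) {f : V → V} {z : V}
    (h : S.shear p f z = 0) : z ∈ S.cone ∧ S.retract (f z) = p := by
  obtain ⟨h1, h2⟩ := S.eq_of_add_conormal_eq_zero hp (S.retract_mem_cone _) h
  refine ⟨S.mem_cone_iff_defect.2 fun k => ?_, h2⟩
  have : 0 < ‖S.proj (k, true) p‖ := norm_pos_iff.2 (hp.2 _)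
  exact (mul_eq_zero.1 (h1 k)).resolve_left (by positivity)

lemma hasFDerivAt_shear_id {p : V} (hp : p ∈ S.regularCone) :
    HasFDerivAt (S.shear p id) (ContinuousLinearMap.id ℝ V) p := by
  have h1 : HasFDerivAt S.retract _ p := HasFDerivAt.fun_sum fun i (_ : i ∈ Finset.univ) =>
    (S.hasFDerivAt_scale hp i).smul (S.proj i).hasFDerivAt
  have h2 := HasFDerivAt.fun_sum fun k (_ : k ∈ Finset.univ) =>
    ((((S.hasStrictFDerivAt_norm_proj_sq (k, true) p).hasFDerivAt.sub
      (S.hasStrictFDerivAt_norm_proj_sq (k, false) p).hasFDerivAt).const_mul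
        (4 * ‖S.proj (k, true) p‖ ^ 2)⁻¹).smul_const (S.conormal p k))
  refine ((h1.sub_const p).add h2).congr_fderiv ?_
  ext v
  have h3 : ∀ i, S.scale i p = 1 := fun i => S.scale_eq_one hp.1 (hp.2 i)
  simp only [h3, add_apply, sum_apply, smul_apply, one_smul,
    ContinuousLinearMap.smulRight_apply, sub_apply, innerSL_apply_apply,
    ContinuousLinearMap.id_apply, inner_smul_left, smul_eq_mul]
  rw [Finset.sum_add_distrib, S.sum_proj, add_assoc, add_eq_left, Fintype.sum_prod_type,
    ← Finset.sum_add_distrib]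
  refine Finset.sum_eq_zero fun k _ => ?_
  rw [Fintype.sum_bool, ← hp.1 k]
  simp only [conormal, Bool.not_true, Bool.not_false, inner_sub_left, smul_sub, conj_trivial]
  generalize inner ℝ (S.proj (k, true) p) v = a
  generalize inner ℝ (S.proj (k, false) p) v = b
  have : 0 < ‖S.proj (k, true) p‖ := norm_pos_iff.2 (hp.2 _)
  generalize ‖S.proj (k, true) p‖ = r at *
  rw [show (2 * r ^ 2)⁻¹ * (a - b) = (4 * r ^ 2)⁻¹ * (2 * a - 2 * b) by field_simp; ring,
    show (2 * r ^ 2)⁻¹ * (b - a) = -((4 * r ^ 2)⁻¹ * (2 * a - 2 * b)) by field_simp; ring]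
  module

/-- A deformation of the cone still covers, after retraction, the regular part of the cone. -/
lemma regularCone_subset_retract_image [FiniteDimensional ℝ V] {f : V → V} (hf : Continuous f)
    {R : ℝ} (hout : ∀ x, R ≤ ‖x‖ → f x = x) :
    S.regularCone ⊆ S.retract '' (f '' S.cone) := by
  intro p hp
  have hp0 : S.shear p id p = 0 := by
    simp [shear, S.retract_eq_self hp.1, S.mem_cone_iff_defect.1 hp.1]
  obtain ⟨z, hz⟩ := exists_zero_of_eq_outside (S.continuous_shear p continuous_id)
    (S.continuous_shear p hf) (p := p) (R := R + ‖p‖)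
    (fun x hx => by
      obtain ⟨h1, h2⟩ := S.mem_cone_of_shear_eq_zero hp hx
      rwa [id, S.retract_eq_self h1] at h2)
    (S.hasFDerivAt_shear_id hp) hp0
    (fun x hx => by
      have := norm_sub_le x p
      rw [shear, shear, hout x (by linarith), id])
  obtain ⟨h1, h2⟩ := S.mem_cone_of_shear_eq_zero hp hz
  exact ⟨f z, mem_image_of_mem f h1, h2⟩

end Surjectivity

end OrthoSplitting

namespace OrthoSplitting

variable {κ V : Type*} [Fintype κ] [NormedAddCommGroup V] [InnerProductSpace ℝ V]
  [FiniteDimensional ℝ V] [MeasurableSpace V] [BorelSpace V] (S : OrthoSplitting (κ × Bool) V)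

/-- The cone does not lose measure under a deformation supported in a ball. -/
lemma hausdorffMeasure_cone_diff_image_le {n : κ → ℕ}
    (hn : ∀ i : κ × Bool,
      Module.finrank ℝ (LinearMap.range (S.proj i : V →ₗ[ℝ] V)) = n i.1 + 1)
    (h3 : ∀ k, 3 ≤ n k)
    (hnull : μH[(∑ k, (2 * n k + 1) : ℕ)] (S.cone \ S.regularCone) = 0)
    {f : V → V} (hf : Continuous f) {R : ℝ} (hout : ∀ x, R ≤ ‖x‖ → f x = x) :
    μH[(∑ k, (2 * n k + 1) : ℕ)] (S.cone \ f '' S.cone) ≤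
      μH[(∑ k, (2 * n k + 1) : ℕ)] (f '' S.cone \ S.cone) := by
  have hsub : S.cone \ f '' S.cone ⊆ (S.cone \ S.regularCone) ∪
      S.retract '' ((f '' S.cone \ S.cone) ∩ S.sector) := by
    rintro x ⟨hx, hxf⟩
    by_cases hreg : x ∈ S.regularCone
    · obtain ⟨w, hw, rfl⟩ := S.regularCone_subset_retract_image hf hout hreg
      refine Or.inr ⟨w, ⟨⟨hw, fun hwE => hxf ?_⟩, S.mem_sector_of_retract_mem hreg⟩, rfl⟩
      rwa [S.retract_eq_self hwE]
    · exact Or.inl ⟨hx, hreg⟩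
  calc _ ≤ _ := measure_mono hsub
    _ ≤ _ := measure_union_le _ _
    _ = μH[(∑ k, (2 * n k + 1) : ℕ)] (S.retract '' ((f '' S.cone \ S.cone) ∩ S.sector)) := by
        rw [hnull, zero_add]
    _ ≤ _ := S.hausdorffMeasure_retract_le hn h3 inter_subset_right
    _ ≤ _ := measure_mono inter_subset_left

end OrthoSplitting

section Coordinates

variable {ι κ : Type*} [Fintype ι] [DecidableEq κ]

lemma hausdorffMeasure_setOf_vanishing (p : ι → κ) (k : κ) {d : ℕ}
    (hd : Fintype.card {j // p j ≠ k} < d) :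
    μH[d] {z : EuclideanSpace ℝ ι | ∀ j, p j = k → z j = 0} = 0 := by
  let L : ({j // p j ≠ k} → ℝ) → EuclideanSpace ℝ ι :=
    fun v => WithLp.toLp 2 fun j => if h : p j = k then 0 else v ⟨j, h⟩
  have hL : ContDiff ℝ 1 L := by
    rw [contDiff_euclidean]
    intro j
    by_cases h : p j = k
    · simpa [L, h] using contDiff_const
    · simpa [L, h] using contDiff_apply ℝ ℝ _
  have hdim : dimH (range L) ≤ (Fintype.card {j // p j ≠ k} : ℕ) := by
    simpa using hL.dimH_range_le
  have hsub : {z : EuclideanSpace ℝ ι | ∀ j, p j = k → z j = 0} ⊆ range L := by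
    intro z hz
    refine ⟨fun j => z j, ?_⟩
    ext j
    by_cases h : p j = k
    · simp [L, h, hz j h]
    · simp [L, h]
  refine measure_mono_null hsub ?_
  have := hausdorffMeasure_of_dimH_lt (s := range L) (d := d)
    (lt_of_le_of_lt hdim (by exact_mod_cast hd))
  simpa using this

variable [Fintype κ]

/-- The splitting of Euclidean space into blocks of coordinates. -/
def OrthoSplitting.ofBlocks (p : ι → κ) : OrthoSplitting κ (EuclideanSpace ℝ ι) where
  proj i := LinearMap.toContinuousLinearMap
    { toFun := fun z => WithLp.toLp 2 fun j => if p j = i then z j else 0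
      map_add' := fun x y => by
        ext j
        by_cases h : p j = i <;> simp [h]
      map_smul' := fun c x => by
        ext j
        by_cases h : p j = i <;> simp [h] }
  sum_proj z := by
    ext j
    simp
  inner_proj_proj i i' h x y := by
    simp only [PiLp.inner_apply]
    refine Finset.sum_eq_zero fun j _ => ?_
    by_cases hj : p j = i
    · simp [hj, h]
    · simp [hj]

lemma OrthoSplitting.ofBlocks_proj_apply (p : ι → κ) (i : κ) (z : EuclideanSpace ℝ ι) (j : ι) :
    (OrthoSplitting.ofBlocks p).proj i z j = if p j = i then z j else 0 := rfl

lemma OrthoSplitting.norm_ofBlocks_proj_sq (p : ι → κ) (i : κ) (z : EuclideanSpace ℝ ι) :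
    ‖(OrthoSplitting.ofBlocks p).proj i z‖ ^ 2 = ∑ j, if p j = i then z j ^ 2 else 0 := by
  rw [EuclideanSpace.real_norm_sq_eq]
  refine Finset.sum_congr rfl fun j _ => ?_
  rw [ofBlocks_proj_apply]
  split_ifs <;> simp

lemma OrthoSplitting.finrank_range_ofBlocks_proj (p : ι → κ) (i : κ) :
    Module.finrank ℝ (LinearMap.range ((OrthoSplitting.ofBlocks p).proj i :
      EuclideanSpace ℝ ι →ₗ[ℝ] EuclideanSpace ℝ ι)) = Fintype.card {j // p j = i} := by
  let e : LinearMap.range ((OrthoSplitting.ofBlocks p).proj i :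
      EuclideanSpace ℝ ι →ₗ[ℝ] EuclideanSpace ℝ ι) ≃ₗ[ℝ] ({j // p j = i} → ℝ) :=
    { toFun := fun z j => (z : EuclideanSpace ℝ ι) j
      map_add' := fun _ _ => rfl
      map_smul' := fun _ _ => rfl
      invFun := fun v => ⟨WithLp.toLp 2 fun j => if h : p j = i then v ⟨j, h⟩ else 0,
        WithLp.toLp 2 fun j => if h : p j = i then v ⟨j, h⟩ else 0, by
          ext j
          change (if p j = i then (if h : p j = i then v ⟨j, h⟩ else 0) else 0) =
            if h : p j = i then v ⟨j, h⟩ else 0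
          by_cases h : p j = i <;> simp [h]⟩
      left_inv := by
        rintro ⟨_, x, rfl⟩
        ext j
        change (if h : p j = i then (if p j = i then x j else 0) else 0) =
          if p j = i then x j else 0
        by_cases h : p j = i <;> simp [h]
      right_inv := fun v => by
        ext ⟨j, hj⟩
        simp [hj] }
  rw [e.finrank_eq, Module.finrank_fintype_fun_eq_card]

lemma OrthoSplitting.hausdorffMeasure_cone_diff_regularCone (p : ι → κ × Bool) {d : ℕ}
    (hd : ∀ k, Fintype.card {j // (p j).1 ≠ k} < d) :
    μH[d] ((ofBlocks p).cone \ (ofBlocks p).regularCone) = 0 := by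
  refine measure_mono_null (t := ⋃ k, {z : EuclideanSpace ℝ ι | ∀ j, (p j).1 = k → z j = 0}) ?_
    (measure_iUnion_null fun k => hausdorffMeasure_setOf_vanishing (fun j => (p j).1) k (hd k))
  rintro z ⟨hz, hreg⟩
  obtain ⟨i, hi⟩ : ∃ i, (ofBlocks p).proj i z = 0 := by
    by_contra! h
    exact hreg ⟨hz, h⟩
  refine mem_iUnion.2 ⟨i.1, fun j hj => ?_⟩
  have hi' : (ofBlocks p).proj (i.1, !i.2) z = 0 := by
    rw [← norm_eq_zero, ← (ofBlocks p).mem_cone_iff.1 hz i, hi, norm_zero]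
  have h0 : (ofBlocks p).proj (p j) z = 0 := by
    by_cases h : (p j).2 = i.2
    · rwa [show p j = i from Prod.ext hj h]
    · rwa [show p j = (i.1, !i.2) from Prod.ext hj (by simpa using Bool.eq_not_of_ne h)]
  have := congrArg (fun w : EuclideanSpace ℝ ι => w j) h0
  simpa [ofBlocks_proj_apply] using this

end Coordinates

section Finiteness

variable {ι κ : Type*} [Fintype ι] [DecidableEq κ]

lemma dist_coord_le_of_quadratic {b : ι → κ} {σ : ι → ℝ} (hσ : ∀ j, |σ j| = 1) {a : κ → ι}
    (ha : ∀ k, b (a k) = k) {ε : κ → ℝ} (hε : ∀ k, |ε k| = 1) {z w : ι → ℝ}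
    (hz : ∀ k, ∑ j, (if b j = k then σ j * z j ^ 2 else 0) = 0)
    (hw : ∀ k, ∑ j, (if b j = k then σ j * w j ^ 2 else 0) = 0)
    (hza : ∀ j, |z j| ≤ ε (b j) * z (a (b j))) (hwa : ∀ j, |w j| ≤ ε (b j) * w (a (b j)))
    {δ : ℝ} (hδ : 0 ≤ δ) (h : ∀ j ∉ range a, |z j - w j| ≤ δ) (k : κ) :
    |z (a k) - w (a k)| ≤ Fintype.card ι * δ := by
  classical
  set u := ε k * z (a k)
  set v := ε k * w (a k)
  have hu : ∀ j, b j = k → |z j| ≤ u := fun j hj => by simpa only [u, hj] using hza j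
  have hv : ∀ j, b j = k → |w j| ≤ v := fun j hj => by simpa only [v, hj] using hwa j
  have hε2 : ε k ^ 2 = 1 := by rw [← sq_abs, hε, one_pow]
  have huv : |z (a k) - w (a k)| = |u - v| := by
    rw [← mul_sub, abs_mul, hε, one_mul]
  have hu0 : 0 ≤ u := (abs_nonneg _).trans (hu _ (ha k))
  have hv0 : 0 ≤ v := (abs_nonneg _).trans (hv _ (ha k))
  have hsum : ∑ j, (if b j = k then σ j * (z j ^ 2 - w j ^ 2) else 0) = 0 := by
    have h1 := (Finset.sum_sub_distrib _ _).trans (congrArg₂ (· - ·) (hz k) (hw k))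
    refine Eq.trans ?_ (h1.trans (sub_zero 0))
    refine Finset.sum_congr rfl fun j _ => ?_
    split_ifs <;> ring
  rw [← Finset.add_sum_erase _ _ (Finset.mem_univ (a k)), if_pos (ha k)] at hsum
  have hmul : |u - v| * (u + v) ≤ Fintype.card ι * δ * (u + v) := by
    calc |u - v| * (u + v) = |σ (a k) * (z (a k) ^ 2 - w (a k) ^ 2)| := by
          rw [abs_mul, hσ, one_mul, ← abs_of_nonneg (add_nonneg hu0 hv0), ← abs_mul]
          congr 1
          simp only [u, v]
          linear_combination (z (a k) ^ 2 - w (a k) ^ 2) * hε2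
      _ = |∑ j ∈ Finset.univ.erase (a k),
            (if b j = k then σ j * (z j ^ 2 - w j ^ 2) else 0)| := by
          rw [eq_neg_of_add_eq_zero_left hsum, abs_neg]
      _ ≤ ∑ j ∈ Finset.univ.erase (a k),
            |if b j = k then σ j * (z j ^ 2 - w j ^ 2) else 0| := Finset.abs_sum_le_sum_abs _ _
      _ ≤ ∑ j ∈ Finset.univ.erase (a k), δ * (u + v) := by
          refine Finset.sum_le_sum fun j hj => ?_
          split_ifs with hjk
          · have hj' : j ∉ range a := by
              rintro ⟨k', rfl⟩
              rw [ha] at hjk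
              subst hjk
              simp at hj
            rw [abs_mul, hσ, one_mul, sq_sub_sq, mul_comm, abs_mul]
            refine mul_le_mul (h j hj') ?_ (abs_nonneg _) hδ
            exact (abs_add_le _ _).trans (add_le_add (hu j hjk) (hv j hjk))
          · rw [abs_zero]
            positivity
      _ ≤ ∑ j : ι, δ * (u + v) :=
          Finset.sum_le_sum_of_subset_of_nonneg (Finset.subset_univ _) fun _ _ _ => by positivity
      _ = Fintype.card ι * δ * (u + v) := by
          rw [Finset.sum_const, nsmul_eq_mul, Finset.card_univ, mul_assoc]
  rw [huv]
  rcases (add_nonneg hu0 hv0).eq_or_lt with h0 | h0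
  · have : u - v = 0 := by linarith
    rw [this, abs_zero]
    positivity
  · exact le_of_mul_le_mul_right hmul h0

/-- An intersection of quadratic cones in separate blocks of variables has locally finite
measure in the expected dimension. -/
lemma hausdorffMeasure_quadratic_inter_closedBall_lt_top [Fintype κ] {b : ι → κ}
    (hb : Function.Surjective b) {σ : ι → ℝ} (hσ : ∀ j, |σ j| = 1) {d : ℕ}
    (hd : d + Fintype.card κ = Fintype.card ι) (x : EuclideanSpace ℝ ι) (R : ℝ) :
    μH[d] ({z : EuclideanSpace ℝ ι | ∀ k, ∑ j, (if b j = k then σ j * z j ^ 2 else 0) = 0} ∩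
      closedBall x R) < ⊤ := by
  classical
  set Q := {z : EuclideanSpace ℝ ι | ∀ k, ∑ j, (if b j = k then σ j * z j ^ 2 else 0) = 0} ∩
      closedBall x R with hQ
  let s : Bool → ℝ := fun e => if e then 1 else -1
  have hs : ∀ e, |s e| = 1 := by rintro (_ | _) <;> simp [s]
  let piece : {a : κ → ι // ∀ k, b (a k) = k} × (κ → Bool) → Set (EuclideanSpace ℝ ι) :=
    fun q => {z ∈ Q | ∀ j, |z j| ≤ s (q.2 (b j)) * z (q.1.1 (b j))}
  have hcover : Q ⊆ ⋃ q, piece q := by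
    intro z hz
    have hmax : ∀ k, ∃ i, b i = k ∧ ∀ j, b j = k → |z j| ≤ |z i| := by
      intro k
      obtain ⟨i, hi, hmax⟩ := Finset.exists_max_image (Finset.univ.filter fun j => b j = k)
        (fun j => |z j|) (by obtain ⟨j, hj⟩ := hb k; exact ⟨j, by simp [hj]⟩)
      exact ⟨i, by simpa using hi, fun j hj => hmax j (by simp [hj])⟩
    choose a ha hmax using hmax
    refine mem_iUnion.2 ⟨⟨⟨a, ha⟩, fun k => decide (0 ≤ z (a k))⟩, hz, fun j => ?_⟩
    refine (hmax _ j rfl).trans ?_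
    by_cases h : 0 ≤ z (a (b j))
    · simp [s, h, abs_of_nonneg h]
    · simp [s, h, abs_of_neg (not_le.1 h)]
  refine (measure_mono hcover).trans_lt ((measure_iUnion_fintype_le _ _).trans_lt
    (ENNReal.sum_lt_top.2 ?_))
  rintro ⟨⟨a, ha⟩, ε⟩ -
  let G : EuclideanSpace ℝ ι → ({j // j ∉ range a} → ℝ) := fun z j => z j
  have hG : ∀ z w, dist (G z) (G w) ≤ dist z w := fun z w =>
    (dist_pi_le_iff dist_nonneg).2 fun j => by
      simpa [Real.dist_eq, dist_eq_norm] using! PiLp.norm_apply_le (z - w) (j : ι)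
  have hcard : Fintype.card {j // j ∉ range a} = d := by
    have hinj : Function.Injective a := fun k k' h => by rw [← ha k, h, ha]
    have h1 := Fintype.card_subtype_compl (fun j => j ∈ range a)
    have h2 : Fintype.card {j // j ∈ range a} = Fintype.card κ := card_range_of_injective hinj
    omega
  obtain ⟨C, hC⟩ : ∃ C : ℝ≥0, ∀ z w : EuclideanSpace ℝ ι,
      dist z w ≤ C * dist (WithLp.ofLp z) (WithLp.ofLp w) :=
    ⟨_, fun z w => (PiLp.lipschitzWith_toLp 2 fun _ : ι => ℝ).dist_le_mul _ _⟩
  have hanti : ∀ z ∈ piece ⟨⟨a, ha⟩, ε⟩, ∀ w ∈ piece ⟨⟨a, ha⟩, ε⟩,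
      edist (id z) (id w) ≤ (C * Fintype.card ι : ℝ≥0) * edist (G z) (G w) := by
    rintro z ⟨⟨hz, -⟩, hza⟩ w ⟨⟨hw, -⟩, hwa⟩
    have hkeep : ∀ j ∉ range a, |z j - w j| ≤ dist (G z) (G w) := fun j hj =>
      dist_le_pi_dist (G z) (G w) ⟨j, hj⟩
    have hdist : dist z w ≤ C * (Fintype.card ι * dist (G z) (G w)) := by
      refine (hC z w).trans (mul_le_mul_of_nonneg_left ?_ C.2)
      refine (dist_pi_le_iff (by positivity)).2 fun j => ?_
      by_cases hj : j ∈ range a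
      · obtain ⟨k, rfl⟩ := hj
        exact dist_coord_le_of_quadratic hσ ha (fun k => hs (ε k)) hz hw hza hwa dist_nonneg
          hkeep k
      · have : (1 : ℝ) ≤ Fintype.card ι := by
          exact_mod_cast Fintype.card_pos_iff.2 ⟨j⟩
        exact (hkeep j hj).trans (le_mul_of_one_le_left dist_nonneg this)
    rw [edist_nndist, edist_nndist, ← ENNReal.coe_mul, ENNReal.coe_le_coe, ← NNReal.coe_le_coe]
    simpa [mul_assoc] using hdist
  have hbdd : Bornology.IsBounded (G '' piece ⟨⟨a, ha⟩, ε⟩) := by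
    refine isBounded_closedBall.subset (image_subset_iff.2 fun z hz => ?_) (t := closedBall (G x) R)
    exact (hG z x).trans hz.1.2
  have hle := hausdorffMeasure_image_le_of_edist_le hanti d.cast_nonneg
  rw [image_id] at hle
  refine hle.trans_lt (ENNReal.mul_lt_top
    (ENNReal.rpow_lt_top_of_nonneg d.cast_nonneg ENNReal.coe_ne_top) ?_)
  rw [← hcard, hausdorffMeasure_pi_real]
  exact hbdd.measure_lt_top

end Finiteness

section Minimality

lemma IsDeformation.continuous {N : ℕ}
    {φ : ℝ → EuclideanSpace ℝ (Fin N) → EuclideanSpace ℝ (Fin N)} (hφ : IsDeformation univ φ) :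
    Continuous (φ 1) := by
  obtain ⟨K, hK⟩ := hφ.2.2.2.1
  rw [closure_univ, lipschitzOnWith_univ] at hK
  exact hK.continuous

lemma IsDeformation.exists_eq_of_le_norm {N : ℕ}
    {φ : ℝ → EuclideanSpace ℝ (Fin N) → EuclideanSpace ℝ (Fin N)} (hφ : IsDeformation univ φ) :
    ∃ R : ℝ, ∀ x, R ≤ ‖x‖ → φ 1 x = x := by
  obtain ⟨R, hR⟩ := hφ.2.2.2.2.2.isBounded.subset_ball 0
  refine ⟨R, fun x hx => ?_⟩
  by_contra hne
  have : x ∈ ball (0 : EuclideanSpace ℝ (Fin N)) R :=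
    hR (subset_closure (mem_biUnion (by simp : (1 : ℝ) ∈ Icc (0 : ℝ) 1)
      (Or.inl ⟨by simp, hne⟩)))
  rw [mem_ball_zero_iff] at this
  exact absurd hx this.not_ge

namespace OrthoSplitting

variable {N : ℕ} {κ : Type*} [Fintype κ] [DecidableEq κ]

lemma mem_cone_ofBlocks_iff {p : Fin N → κ × Bool} {z : EuclideanSpace ℝ (Fin N)} :
    z ∈ (ofBlocks p).cone ↔ ∀ k, ∑ j, (if p j = (k, true) then z j ^ 2 else 0) =
      ∑ j, if p j = (k, false) then z j ^ 2 else 0 := by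
  refine forall_congr' fun k => ?_
  rw [← norm_ofBlocks_proj_sq, ← norm_ofBlocks_proj_sq,
    pow_left_inj₀ (norm_nonneg _) (norm_nonneg _) two_ne_zero]

lemma cone_ofBlocks_eq (p : Fin N → κ × Bool) :
    (ofBlocks p).cone = {z : EuclideanSpace ℝ (Fin N) | ∀ k, ∑ j,
      (if (p j).1 = k then (if (p j).2 then (1 : ℝ) else -1) * z j ^ 2 else 0) = 0} := by
  ext z
  rw [mem_cone_ofBlocks_iff]
  refine forall_congr' fun k => ?_
  rw [← sub_eq_zero, ← Finset.sum_sub_distrib]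
  refine Eq.congr_left (Finset.sum_congr rfl fun j _ => ?_)
  rcases p j with ⟨k', _ | _⟩ <;> by_cases h : k' = k <;> simp [h]

/-- A product of at most seven Simons-type cones, each over a product of two equidimensional
spheres of dimension at least three, is minimal. -/
theorem almgrenMinimal_cone_ofBlocks (p : Fin N → κ × Bool) {n : κ → ℕ}
    (hn : ∀ i, Fintype.card {j // p j = i} = n i.1 + 1) (h3 : ∀ k, 3 ≤ n k)
    (hκ : Fintype.card κ < 8) :
    AlmgrenMinimal (∑ k, (2 * n k + 1) : ℕ) univ (ofBlocks p).cone := by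
  have hfiber : ∀ k, Fintype.card {j // (p j).1 = k} = 2 * n k + 2 := by
    intro k
    have h1 : ∀ s, (Finset.univ.filter fun j => p j = (k, s)).card = n k + 1 := fun s => by
      rw [← Fintype.card_subtype]
      exact hn (k, s)
    rw [Fintype.card_subtype, show (Finset.univ.filter fun j => (p j).1 = k) =
      (Finset.univ.filter fun j => p j = (k, true)) ∪
        Finset.univ.filter fun j => p j = (k, false) from ?_, Finset.card_union_of_disjoint, h1, h1]
    · ring
    · refine Finset.disjoint_filter.2 fun j _ h h' => ?_
      simp [h] at h'
    · ext j
      rcases h : p j with ⟨k', _ | _⟩ <;> simp [h]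
  have hN : (∑ k, (2 * n k + 1)) + Fintype.card κ = N := by
    calc _ = ∑ k, (2 * n k + 2) := by
          rw [Fintype.card_eq_sum_ones, ← Finset.sum_add_distrib]
      _ = ∑ k, Fintype.card {j // (p j).1 = k} := Finset.sum_congr rfl fun k _ => (hfiber k).symm
      _ = N := by
          rw [← Fintype.card_sigma, Fintype.card_congr (Equiv.sigmaFiberEquiv fun j => (p j).1),
            Fintype.card_fin]
  have hnull : μH[(∑ k, (2 * n k + 1) : ℕ)]
      ((ofBlocks p).cone \ (ofBlocks p).regularCone) = 0 := by
    refine hausdorffMeasure_cone_diff_regularCone p fun k => ?_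
    have h1 : Fintype.card {j // (p j).1 ≠ k} = N - (2 * n k + 2) :=
      (Fintype.card_subtype_compl _).trans (by rw [hfiber, Fintype.card_fin])
    have h2 := h3 k
    have h4 := Fintype.card_subtype_le (fun j => (p j).1 = k)
    rw [hfiber, Fintype.card_fin] at h4
    omega
  refine ⟨isClosed_cone _, by simp, fun x r _ => ?_, fun φ hφ => ?_⟩
  · rw [cone_ofBlocks_eq]
    refine hausdorffMeasure_quadratic_inter_closedBall_lt_top (fun k => ?_) (fun j => ?_)
      (by rw [hN, Fintype.card_fin]) x r
    · have : 0 < Fintype.card {j // (p j).1 = k} := by rw [hfiber]; omega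
      obtain ⟨j, hj⟩ := Fintype.card_pos_iff.1 this
      exact ⟨j, hj⟩
    · split_ifs <;> simp
  · obtain ⟨R, hR⟩ := hφ.exists_eq_of_le_norm
    refine (ofBlocks p).hausdorffMeasure_cone_diff_image_le (fun i => ?_) h3 hnull
      hφ.continuous hR
    rw [finrank_range_ofBlocks_proj, hn]

end OrthoSplitting

/-- The block of `2 * m + 2 * l` coordinates containing a given one. -/
def simonsBlock (m l : ℕ) (j : Fin (2 * m + 2 * l)) : Bool × Bool :=
  if (j : ℕ) < 2 * m then (true, decide ((j : ℕ) < m))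
  else (false, decide ((j : ℕ) < 2 * m + l))

lemma simonsBlock_eq_iff {m l : ℕ} {j : Fin (2 * m + 2 * l)} {i : Bool × Bool} :
    simonsBlock m l j = i ↔
      (match i with
        | (true, true) => 0
        | (true, false) => m
        | (false, true) => 2 * m
        | (false, false) => 2 * m + l) ≤ (j : ℕ) ∧
      (j : ℕ) < match i with
        | (true, true) => m
        | (true, false) => 2 * m
        | (false, true) => 2 * m + l
        | (false, false) => 2 * m + 2 * l := by
  have := j.2
  rcases i with ⟨_ | _, _ | _⟩ <;> by_cases h : (j : ℕ) < 2 * m <;>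
    simp only [simonsBlock, h, if_true, if_false, Prod.mk.injEq, decide_eq_true_eq,
      decide_eq_false_iff_not, true_and, false_and, reduceCtorEq] <;> grind

lemma card_fin_between {N a b : ℕ} (hb : b ≤ N) :
    Fintype.card {j : Fin N // a ≤ (j : ℕ) ∧ (j : ℕ) < b} = b - a := by
  rw [← Nat.card_Ico, ← Fintype.card_coe]
  exact Fintype.card_congr
    { toFun := fun j => ⟨j.1, Finset.mem_Ico.2 j.2⟩
      invFun := fun x =>
        ⟨⟨x, (Finset.mem_Ico.1 x.2).2.trans_le hb⟩, Finset.mem_Ico.1 x.2⟩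
      left_inv := fun _ => rfl
      right_inv := fun _ => rfl }

end Minimality

/-- For integers m ≥ 4 and l ≥ 4, the product
`S_m × S_l = {(x,y,z,w) : |x| = |y|, |z| = |w|}` of two generalized Simons cones
(written in ℝ^{2m+2l}, with coordinate blocks `[0,m), [m,2m), [2m,2m+l), [2m+l,2m+2l)`)
is an Almgren minimal set of dimension 2m+2l−2 in ℝ^{2m+2l}. -/
theorem product_of_simons_cones_almgren_minimal (m l : ℕ) (hm : 4 ≤ m) (hl : 4 ≤ l) :
    AlmgrenMinimal ((2*m + 2*l - 2 : ℕ) : ℝ) (Set.univ)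
      {z : EuclideanSpace ℝ (Fin (2*m + 2*l)) |
        sumSq z 0 m = sumSq z m (2*m) ∧
        sumSq z (2*m) (2*m + l) = sumSq z (2*m + l) (2*m + 2*l)} := by
  have h := OrthoSplitting.almgrenMinimal_cone_ofBlocks (simonsBlock m l)
    (n := fun k => if k then m - 1 else l - 1) (fun i => ?_) (fun k => ?_) (by simp)
  · convert h using 2
    · simp only [Fintype.sum_bool, if_true, Bool.false_eq_true, if_false]
      omega
    · ext z
      rw [OrthoSplitting.mem_cone_ofBlocks_iff, Bool.forall_bool, and_comm]
      simp only [simonsBlock_eq_iff]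
      rfl
  · simp only [simonsBlock_eq_iff]
    rw [card_fin_between] <;> rcases i with ⟨_ | _, _ | _⟩ <;> simp <;> omega
  · rcases k with _ | _ <;> simp <;> omega

end
end

section
/- (Lemma 2.8.) Let U ⊆ ℝ^n be open, W ⊆ U open, and v : W → ℝ^n a C^1 divergence-free vector field with v(x) ≠ 0 for all x ∈ W. Let E ⊆ closure(U) be a closed set that meets the image of each maximal integral curve of v in at most one point. For x ∈ W let γ_x denote the image of the maximal integral curve of v through x, let W₀ = ⋃ {γ_x : x ∈ E ∩ W}, and let p : W₀ → E ∩ W be the map sending each point of W₀ to the unique point of E lying on its maximal integral curve. Assume that ℋ^{n−1}(p(N)) ≤ ℋ^{n−1}(N) for every subset N ⊆ W₀. Then for every set Z ⊆ closure(U) such that ℋ^{n−1}(Z) = 0, Z ∩ W = ∅, and Z ∩ U is relatively closed in U, the set E_Z = {x ∈ E ∩ W : closure(γ_x) ∩ Z ≠ ∅} satisfies ℋ^{n−1}(E_Z) = 0. In particular this applies with Z = U \ W when ℋ^{n−1}(U \ W) = 0 (part 1°), and with Z any closed subset of ∂U with ℋ^{n−1}(Z) = 0 (part 2°). -/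
open Set MeasureTheory Metric NNReal

noncomputable section

/-- A maximal integral curve of the vector field v inside the open set W: a curve
γ : I → W, defined on a nonempty open interval I, with γ' = v ∘ γ, which cannot be
extended to an integral curve (with values in W) on a strictly larger open interval. -/
structure MaxIntCurve {n : ℕ} (v : EuclideanSpace ℝ (Fin n) → EuclideanSpace ℝ (Fin n))
    (W : Set (EuclideanSpace ℝ (Fin n))) where
  I : Set ℝ
  γ : ℝ → EuclideanSpace ℝ (Fin n)
  isOpen_I : IsOpen I
  ordConnected_I : I.OrdConnected
  nonempty_I : I.Nonempty
  mapsTo : ∀ t ∈ I, γ t ∈ W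
  isIntegral : ∀ t ∈ I, HasDerivAt γ (v (γ t)) t
  maximal : ∀ (J : Set ℝ) (c : ℝ → EuclideanSpace ℝ (Fin n)),
    IsOpen J → J.OrdConnected → I ⊆ J → (∀ t ∈ J, c t ∈ W) →
    (∀ t ∈ J, HasDerivAt c (v (c t)) t) → Set.EqOn c γ I → J = I

open scoped ENNReal Topology

/-- A set of zero `d`-dimensional Hausdorff measure, `d > 0`, can be covered by countably many
balls of positive radii whose `d`-th powers have an arbitrarily small sum. -/
theorem exists_ball_cover_of_hausdorffMeasure_eq_zero {X : Type*} [MetricSpace X] [Nonempty X]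
    [MeasurableSpace X] [BorelSpace X] {d : ℝ} (hd : 0 < d) {Z : Set X} (hZ : μH[d] Z = 0)
    {ε : ℝ≥0∞} (hε : ε ≠ 0) :
    ∃ (c : ℕ → X) (r : ℕ → ℝ≥0), (∀ i, 0 < r i) ∧ (∀ i, (r i : ℝ≥0∞) ≤ ε) ∧
      Z ⊆ ⋃ i, ball (c i) (r i) ∧ ∑' i, (r i : ℝ≥0∞) ^ d ≤ ε := by
  obtain ⟨δ, hδ0, hδ⟩ := exists_between (pos_iff_ne_zero.2 hε)
  have hε2 : ε / 2 ≠ 0 := by simpa using hε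
  obtain ⟨t, hZt, htδ, hts⟩ : ∃ t : ℕ → Set X, Z ⊆ ⋃ n, t n ∧ (∀ n, ediam (t n) ≤ δ) ∧
      ∑' n, ⨆ (_ : (t n).Nonempty), ediam (t n) ^ d < ε / 2 := by
    have h : ⨅ (t : ℕ → Set X) (_ : Z ⊆ ⋃ n, t n) (_ : ∀ n, ediam (t n) ≤ δ),
        ∑' n, ⨆ (_ : (t n).Nonempty), ediam (t n) ^ d < ε / 2 := by
      refine lt_of_le_of_lt ?_ (pos_iff_ne_zero.2 hε2)
      rw [← hZ, Measure.hausdorffMeasure_apply]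
      exact le_iSup₂ (f := fun (r : ℝ≥0∞) (_ : 0 < r) => ⨅ (t : ℕ → Set X) (_ : Z ⊆ ⋃ n, t n)
        (_ : ∀ n, ediam (t n) ≤ r), ∑' n, ⨆ (_ : (t n).Nonempty), ediam (t n) ^ d) δ hδ0
    simpa only [iInf_lt_iff, exists_prop] using h
  obtain ⟨η, hη0, hη⟩ := ENNReal.exists_pos_sum_of_countable hε2 ℕ
  have hr : ∀ i, ∃ r : ℝ≥0, ediam (t i) < r ∧ (r : ℝ≥0∞) ≤ ε ∧
      (r : ℝ≥0∞) ^ d ≤ ediam (t i) ^ d + η i := by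
    intro i
    have hlt : ediam (t i) < ε := (htδ i).trans_lt hδ
    have htop : ediam (t i) ^ d ≠ ⊤ := ENNReal.rpow_ne_top_of_nonneg hd.le hlt.ne_top
    have hlt' : ediam (t i) ^ d < ediam (t i) ^ d + η i :=
      ENNReal.lt_add_right htop (by simpa using (hη0 i).ne')
    have h1 : ∀ᶠ x in 𝓝 (ediam (t i)), x ^ d < ediam (t i) ^ d + η i :=
      (ENNReal.continuous_rpow_const (y := d)).continuousAt.eventually_lt_const hlt'
    have hne : (𝓝[>] (ediam (t i))).NeBot := nhdsGT_neBot_of_exists_gt ⟨ε, hlt⟩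
    obtain ⟨x, ⟨hx1, hx2⟩, hx3⟩ := (((h1.filter_mono nhdsWithin_le_nhds).and
      ((eventually_lt_nhds hlt).filter_mono nhdsWithin_le_nhds)).and
        (self_mem_nhdsWithin : Ioi (ediam (t i)) ∈ 𝓝[>] ediam (t i))).exists
    lift x to ℝ≥0 using hx2.ne_top
    exact ⟨x, hx3, hx2.le, hx1.le⟩
  choose r hr1 hr2 hr3 using hr
  have hc : ∀ i, ∃ c, t i ⊆ ball c (r i) := by
    intro i
    rcases (t i).eq_empty_or_nonempty with h | ⟨c, hc⟩
    · exact ⟨Classical.arbitrary X, by simp [h]⟩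
    · refine ⟨c, fun y hy => ?_⟩
      have : edist y c < r i := (edist_le_ediam_of_mem hy hc).trans_lt (hr1 i)
      rw [edist_nndist, ENNReal.coe_lt_coe] at this
      rw [mem_ball, dist_nndist]
      exact_mod_cast this
  choose c hc using hc
  refine ⟨c, r, fun i => ?_, hr2, hZt.trans (iUnion_mono hc), ?_⟩
  · exact_mod_cast (zero_le (a := ediam (t i))).trans_lt (hr1 i)
  · calc ∑' i, (r i : ℝ≥0∞) ^ d ≤ ∑' i, (ediam (t i) ^ d + η i) := ENNReal.tsum_le_tsum hr3
      _ = ∑' i, ediam (t i) ^ d + ∑' i, (η i : ℝ≥0∞) := ENNReal.tsum_add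
      _ ≤ ε / 2 + ε / 2 := by
        refine add_le_add (le_trans (ENNReal.tsum_le_tsum fun i => ?_) hts.le) hη.le
        rcases (t i).eq_empty_or_nonempty with h | h
        · simp [h, hd]
        · simp [h]
      _ = ε := ENNReal.add_halves ε

/-- A Borel–Cantelli lemma for Hausdorff measures: the upper limit of a sequence of countable
families of sets, whose diameters have `d`-th powers with finite total sum, is a null set. -/
theorem hausdorffMeasure_eq_zero_of_subset_iUnion_tail {X : Type*} [MetricSpace X]
    [MeasurableSpace X] [BorelSpace X] {d : ℝ} (hd : 0 < d) {s : Set X} {t : ℕ → ℕ → Set X}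
    {r : ℕ → ℕ → ℝ≥0} {L : ℝ≥0} (ht : ∀ k i, ediam (t k i) ≤ L * r k i) {e : ℕ → ℝ≥0∞}
    (he : ∑' k, e k ≠ ⊤) (hre : ∀ k i, (r k i : ℝ≥0∞) ≤ e k)
    (hrs : ∀ k, ∑' i, (r k i : ℝ≥0∞) ^ d ≤ e k)
    (hs : ∀ K, s ⊆ ⋃ k, ⋃ i, t (k + K) i) : μH[d] s = 0 := by
  have htail := ENNReal.tendsto_sum_nat_add e he
  have hmul : ∀ a : ℝ≥0∞, a ≠ ⊤ →
      Filter.Tendsto (fun K => a * ∑' k, e (k + K)) Filter.atTop (𝓝 0) := fun a ha => by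
    simpa using ENNReal.Tendsto.const_mul htail (Or.inr ha)
  have hLd : (L : ℝ≥0∞) ^ d ≠ ⊤ := ENNReal.rpow_ne_top_of_nonneg hd.le ENNReal.coe_ne_top
  have hle := Measure.hausdorffMeasure_le_liminf_tsum (β := ℕ) (ι := fun _ => ℕ × ℕ) d s
    (l := Filter.atTop) _ (hmul L ENNReal.coe_ne_top) (fun K q => t (q.1 + K) q.2)
    (Filter.Eventually.of_forall fun K q => (ht _ _).trans (mul_le_mul_right
      ((hre _ _).trans (ENNReal.le_tsum (f := fun k => e (k + K)) q.1)) _))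
    (Filter.Eventually.of_forall fun K => by
      rw [iUnion_prod']
      exact hs K)
  refine le_antisymm (hle.trans ?_) (zero_le)
  rw [← (hmul _ hLd).liminf_eq]
  refine Filter.liminf_le_liminf (Filter.Eventually.of_forall fun K => ?_)
  calc ∑' q : ℕ × ℕ, ediam (t (q.1 + K) q.2) ^ d
      = ∑' k, ∑' i, ediam (t (k + K) i) ^ d :=
        ENNReal.tsum_prod (f := fun k i => ediam (t (k + K) i) ^ d)
    _ ≤ ∑' k, ∑' i, (L : ℝ≥0∞) ^ d * (r (k + K) i : ℝ≥0∞) ^ d := by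
        refine ENNReal.tsum_le_tsum fun k => ENNReal.tsum_le_tsum fun i => ?_
        rw [← ENNReal.mul_rpow_of_nonneg _ _ hd.le]
        exact ENNReal.rpow_le_rpow (ht _ _) hd.le
    _ ≤ (L : ℝ≥0∞) ^ d * ∑' k, e (k + K) := by
        simp_rw [ENNReal.tsum_mul_left]
        exact mul_le_mul_right (ENNReal.tsum_le_tsum fun k => hrs _) _

/-- The boundary of a cube of half-side `r` in `ℝ^(m+1)` has `m`-dimensional Hausdorff measure
at most a constant times `r ^ m`. -/
theorem exists_hausdorffMeasure_cube_boundary_le (m : ℕ) :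
    ∃ C : ℝ≥0∞, C ≠ ⊤ ∧ ∀ (c : EuclideanSpace ℝ (Fin (m + 1))) (r : ℝ≥0), 0 < r →
      μH[(m : ℝ)] {y : EuclideanSpace ℝ (Fin (m + 1)) | dist y.ofLp c.ofLp = r} ≤
        C * (r : ℝ≥0∞) ^ (m : ℝ) := by
  have hL := PiLp.lipschitzWith_toLp 2 (fun _ : Fin (m + 1) => ℝ)
  set L : ℝ≥0 := (Fintype.card (Fin (m + 1)) : ℝ≥0) ^ (1 / (2 : ℝ≥0∞)).toReal
  have hface : ∀ (i : Fin (m + 1)) (s : ℝ) (a : Fin m → ℝ) (r : ℝ≥0),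
      μH[(m : ℝ)] ((fun y : Fin m → ℝ => WithLp.toLp 2 (i.insertNth s y : Fin (m + 1) → ℝ)) ''
        closedBall a r) ≤ (L : ℝ≥0∞) ^ (m : ℝ) * ((2 : ℝ≥0∞) ^ m * (r : ℝ≥0∞) ^ (m : ℝ)) := by
    intro i s a r
    have h1 : LipschitzWith 1 (fun y : Fin m → ℝ => (i.insertNth s y : Fin (m + 1) → ℝ)) := by
      refine LipschitzWith.of_dist_le_mul fun y z => ?_
      rw [NNReal.coe_one, one_mul, dist_pi_le_iff dist_nonneg]
      intro j
      induction j using Fin.succAboveCases i with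
      | x => simp
      | p j => simpa using dist_le_pi_dist y z j
    have h2 := (hL.comp h1).hausdorffMeasure_image_le m.cast_nonneg (closedBall a r)
    have hvol : (μH[(m : ℝ)] : Measure (Fin m → ℝ)) = volume := by
      simpa using hausdorffMeasure_pi_real (ι := Fin m)
    rw [hvol, Real.volume_pi_closedBall a r.coe_nonneg, mul_one] at h2
    refine h2.trans_eq ?_
    congr 1
    rw [Fintype.card_fin, ENNReal.ofReal_pow (by positivity), ENNReal.ofReal_mul zero_le_two,
      mul_pow, ENNReal.ofReal_coe_nnreal, ENNReal.rpow_natCast]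
    simp
  refine ⟨∑ _i : Fin (m + 1), 2 * ((L : ℝ≥0∞) ^ (m : ℝ) * (2 : ℝ≥0∞) ^ m), ?_, ?_⟩
  · have := ENNReal.rpow_ne_top_of_nonneg (m.cast_nonneg (α := ℝ)) (ENNReal.coe_ne_top (r := L))
    refine ENNReal.sum_ne_top.2 fun _ _ => ?_
    finiteness
  intro c r hr
  have hsub : {y : EuclideanSpace ℝ (Fin (m + 1)) | dist y.ofLp c.ofLp = r} ⊆
      ⋃ i : Fin (m + 1), ((fun y : Fin m → ℝ =>
          WithLp.toLp 2 (i.insertNth (c i + r) y : Fin (m + 1) → ℝ)) ''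
            closedBall (i.removeNth c.ofLp) r ∪
        (fun y : Fin m → ℝ => WithLp.toLp 2 (i.insertNth (c i - r) y : Fin (m + 1) → ℝ)) ''
            closedBall (i.removeNth c.ofLp) r) := by
    intro y (hy : dist y.ofLp c.ofLp = r)
    have hle : ∀ i, dist (y i) (c i) ≤ r := fun i => hy ▸ dist_le_pi_dist y.ofLp c.ofLp i
    obtain ⟨i, hi⟩ : ∃ i, dist (y i) (c i) = r := by
      by_contra! h
      exact ((dist_pi_lt_iff (NNReal.coe_pos.2 hr)).2 fun i => (hle i).lt_of_ne (h i)).ne hy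
    have hmem : i.removeNth y.ofLp ∈ closedBall (i.removeNth c.ofLp) (r : ℝ) :=
      mem_closedBall.2 ((dist_pi_le_iff r.coe_nonneg).2 fun j => hle _)
    rw [Real.dist_eq] at hi
    refine mem_iUnion.2 ⟨i, (eq_or_eq_neg_of_abs_eq hi).imp (fun h => ⟨_, hmem, ?_⟩)
      fun h => ⟨_, hmem, ?_⟩⟩
    · have h' : c i + r = y i := by linarith
      simp [h', Fin.insertNth_removeNth]
    · have h' : c i - r = y i := by linarith
      simp [h', Fin.insertNth_removeNth]
  refine (measure_mono hsub).trans ((measure_iUnion_fintype_le _ _).trans ?_)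
  rw [Finset.sum_mul]
  refine Finset.sum_le_sum fun i _ => (measure_union_le _ _).trans ?_
  rw [mul_assoc, two_mul, mul_assoc]
  exact add_le_add (hface _ _ _ _) (hface _ _ _ _)

/-- If `Z` is `ℋ^m`-null in `ℝ^(m+1)`, a set `S` is `ℋ^m`-null as soon as every `x ∈ S` lies on a
connected set `Γ x` whose closure meets `Z`, and the hypersurface measure of any set `A` controls
that of the set of all `x ∈ S` for which `Γ x` meets `A`. -/
theorem hausdorffMeasure_eq_zero_of_closure_inter_nonempty {m : ℕ} (hm : 0 < m)
    {S Z : Set (EuclideanSpace ℝ (Fin (m + 1)))} (hZ : μH[(m : ℝ)] Z = 0)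
    {Γ : EuclideanSpace ℝ (Fin (m + 1)) → Set (EuclideanSpace ℝ (Fin (m + 1)))}
    (hconn : ∀ x ∈ S, IsPreconnected (Γ x)) (hmem : ∀ x ∈ S, x ∈ Γ x)
    (hmeet : ∀ x ∈ S, (closure (Γ x) ∩ Z).Nonempty)
    (harea : ∀ A : Set (EuclideanSpace ℝ (Fin (m + 1))),
      μH[(m : ℝ)] {x ∈ S | (Γ x ∩ A).Nonempty} ≤ μH[(m : ℝ)] A) :
    μH[(m : ℝ)] S = 0 := by
  have hm' : (0 : ℝ) < m := Nat.cast_pos.2 hm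
  obtain ⟨C, hC, hCS⟩ := exists_hausdorffMeasure_cube_boundary_le m
  obtain ⟨e, he0, hes⟩ := ENNReal.exists_pos_sum_of_countable one_ne_zero ℕ
  choose c r hr0 hre hcov hsum using fun k => exists_ball_cover_of_hausdorffMeasure_eq_zero hm' hZ
    (ε := e k) (by simpa using (he0 k).ne')
  have hcont : ∀ a : EuclideanSpace ℝ (Fin (m + 1)),
      Continuous fun y : EuclideanSpace ℝ (Fin (m + 1)) => dist y.ofLp a.ofLp := fun a =>
    (PiLp.continuous_ofLp 2 _).dist continuous_const
  let Q : ℕ → ℕ → Set (EuclideanSpace ℝ (Fin (m + 1))) := fun k i =>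
    {y | dist y.ofLp (c k i).ofLp < r k i}
  have hcross : ∀ k, ∀ x ∈ S \ ⋃ i, Q k i,
      ∃ i, (Γ x ∩ {y | dist y.ofLp (c k i).ofLp = r k i}).Nonempty := by
    rintro k x ⟨hx, hxQ⟩
    obtain ⟨z, hzΓ, hzZ⟩ := hmeet x hx
    obtain ⟨i, hi⟩ := mem_iUnion.1 (hcov k hzZ)
    obtain ⟨y, hyb, hyΓ⟩ := mem_closure_iff.1 hzΓ _ isOpen_ball hi
    have hyQ : dist y.ofLp (c k i).ofLp ≤ r k i := by
      have h := (PiLp.lipschitzWith_ofLp 2 (fun _ : Fin (m + 1) => ℝ)).dist_le_mul y (c k i)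
      rw [NNReal.coe_one, one_mul] at h
      exact h.trans (mem_ball.1 hyb).le
    have hxQ' : (r k i : ℝ) ≤ dist x.ofLp (c k i).ofLp :=
      not_lt.1 fun h => hxQ (mem_iUnion.2 ⟨i, h⟩)
    obtain ⟨w, hw, hwr⟩ := (hconn x hx).intermediate_value hyΓ (hmem x hx)
      (hcont (c k i)).continuousOn ⟨hyQ, hxQ'⟩
    exact ⟨i, w, hw, hwr⟩
  let R : ℕ → ℕ → Set (EuclideanSpace ℝ (Fin (m + 1))) := fun k i =>
    {y | dist y.ofLp (c k i).ofLp = r k i}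
  have hR : ∀ k, μH[(m : ℝ)] (⋃ i, R k i) ≤ C * e k := fun k => by
    refine (measure_iUnion_le _).trans ?_
    refine (ENNReal.tsum_le_tsum fun i => hCS (c k i) (r k i) (hr0 k i)).trans ?_
    rw [ENNReal.tsum_mul_left]
    exact mul_le_mul_right (hsum k) C
  have hout : ∀ k, μH[(m : ℝ)] (S \ ⋃ i, Q k i) ≤ C * e k := fun k => by
    refine le_trans (measure_mono fun x hx => ?_) ((harea (⋃ i, R k i)).trans (hR k))
    obtain ⟨i, w, hw, hwr⟩ := hcross k x hx
    exact ⟨hx.1, w, hw, mem_iUnion.2 ⟨i, hwr⟩⟩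
  have hsummable : ∑' k, (e k : ℝ≥0∞) ≠ ⊤ := hes.ne_top
  have hlim : Filter.Tendsto (fun k => C * (e k : ℝ≥0∞)) Filter.atTop (𝓝 0) := by
    simpa using ENNReal.Tendsto.const_mul
      (ENNReal.tendsto_atTop_zero_of_tsum_ne_top hsummable) (Or.inr hC)
  have htail : ∀ K, μH[(m : ℝ)] (S \ ⋃ k, ⋃ i, Q (k + K) i) = 0 := fun K =>
    le_antisymm (ge_of_tendsto ((Filter.tendsto_add_atTop_iff_nat K).2 hlim)
      (Filter.Eventually.of_forall fun k => (measure_mono (sdiff_subset_sdiff_right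
        (subset_iUnion (fun k => ⋃ i, Q (k + K) i) k))).trans (hout (k + K)))) (zero_le)
  have hL := PiLp.lipschitzWith_toLp 2 (fun _ : Fin (m + 1) => ℝ)
  set L : ℝ≥0 := (Fintype.card (Fin (m + 1)) : ℝ≥0) ^ (1 / (2 : ℝ≥0∞)).toReal
  have hdiam : ∀ k i, ediam (Q k i) ≤ (L * 2 : ℝ≥0) * r k i := fun k i => by
    have hsub : Q k i ⊆ WithLp.toLp 2 '' eball (c k i).ofLp (r k i) := fun y hy =>
      ⟨y.ofLp, by rwa [eball_coe], rfl⟩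
    refine (ediam_mono hsub).trans ((hL.ediam_image_le _).trans ?_)
    rw [ENNReal.coe_mul, mul_assoc]
    exact mul_le_mul_right ediam_eball_le _
  have hlimsup : μH[(m : ℝ)] (⋂ K, ⋃ k, ⋃ i, Q (k + K) i) = 0 :=
    hausdorffMeasure_eq_zero_of_subset_iUnion_tail hm' hdiam hsummable hre hsum
      fun K => iInter_subset _ K
  refine measure_mono_null (t := (⋂ K, ⋃ k, ⋃ i, Q (k + K) i) ∪
    ⋃ K, S \ ⋃ k, ⋃ i, Q (k + K) i) (fun x hx => ?_)
    (measure_union_null hlimsup (measure_iUnion_null htail))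
  rw [← sdiff_iInter]
  exact (em _).imp_right fun h => ⟨hx, h⟩

/-- Lemma 2.8: Let U ⊆ ℝ^n be open, W ⊆ U open, v a C¹ divergence-free
vector field on W, nonvanishing on W.  Let E ⊆ closure U be closed and meet the image of
each maximal integral curve of v in at most one point.  Let Γ x be the image of the maximal
integral curve through x (for x ∈ W), W₀ the union of the curves through points of E ∩ W,
and p : W₀ → E ∩ W the projection along the curves.  Assume ℋ^{n−1}(p(N)) ≤ ℋ^{n−1}(N) for
all N ⊆ W₀.  Then for every Z ⊆ closure U with ℋ^{n−1}(Z) = 0, Z ∩ W = ∅ and Z ∩ U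
relatively closed in U, the set E_Z of points x ∈ E ∩ W whose curve closure meets Z is
ℋ^{n−1}-null. -/
theorem curves_touching_null_set_are_null (n : ℕ)
    (U W : Set (EuclideanSpace ℝ (Fin n))) (hUopen : IsOpen U) (hWopen : IsOpen W)
    (hWU : W ⊆ U)
    (v : EuclideanSpace ℝ (Fin n) → EuclideanSpace ℝ (Fin n))
    (hv : ContDiffOn ℝ 1 v W) (hvne : ∀ x ∈ W, v x ≠ 0)
    (hdiv : ∀ x ∈ W, ∑ i, (fderiv ℝ v x) (EuclideanSpace.single i (1:ℝ)) i = 0)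
    (E : Set (EuclideanSpace ℝ (Fin n))) (hE : IsClosed E) (hEU : E ⊆ closure U)
    (hmult : ∀ c : MaxIntCurve v W, (E ∩ c.γ '' c.I).Subsingleton)
    -- Γ x is the image of the (unique) maximal integral curve through x, for x ∈ W:
    (Γ : EuclideanSpace ℝ (Fin n) → Set (EuclideanSpace ℝ (Fin n)))
    (hΓ : ∀ x ∈ W, ∀ c : MaxIntCurve v W, ∀ t ∈ c.I, c.γ t = x → Γ x = c.γ '' c.I)
    (hΓex : ∀ x ∈ W, ∃ c : MaxIntCurve v W, ∃ t ∈ c.I, c.γ t = x)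
    (W₀ : Set (EuclideanSpace ℝ (Fin n))) (hW₀ : W₀ = ⋃ x ∈ E ∩ W, Γ x)
    -- p sends each point of W₀ to the unique point of E on its maximal integral curve:
    (p : EuclideanSpace ℝ (Fin n) → EuclideanSpace ℝ (Fin n))
    (hp : ∀ y ∈ W₀, p y ∈ E ∩ W ∧ p y ∈ Γ y)
    (harea : ∀ N : Set (EuclideanSpace ℝ (Fin n)), N ⊆ W₀ →
      μH[(n:ℝ) - 1] (p '' N) ≤ μH[(n:ℝ) - 1] N)
    (Z : Set (EuclideanSpace ℝ (Fin n))) (hZU : Z ⊆ closure U)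
    (hZnull : μH[(n:ℝ) - 1] Z = 0) (hZW : Z ∩ W = ∅)
    (hZclosed : ∃ C : Set (EuclideanSpace ℝ (Fin n)), IsClosed C ∧ Z ∩ U = C ∩ U) :
    μH[(n:ℝ) - 1] {x ∈ E ∩ W | (closure (Γ x) ∩ Z).Nonempty} = 0 := by
  rcases n with _ | m
  · have : {x ∈ E ∩ W | (closure (Γ x) ∩ Z).Nonempty} = ∅ :=
      eq_empty_of_forall_notMem fun x hx => hvne x hx.1.2 (Subsingleton.elim _ _)
    rw [this, measure_empty]
  have hcast : ((m + 1 : ℕ) : ℝ) - 1 = m := by simp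
  rw [hcast] at harea hZnull ⊢
  rcases Nat.eq_zero_or_pos m with rfl | hm
  · have : {x ∈ E ∩ W | (closure (Γ x) ∩ Z).Nonempty} = ∅ := by
      refine eq_empty_of_forall_notMem fun x ⟨_, z, _, hz⟩ => ?_
      have h := measure_mono_null (singleton_subset_iff.2 hz) hZnull
      rw [Nat.cast_zero, Measure.hausdorffMeasure_zero_singleton] at h
      exact one_ne_zero h
    rw [this, measure_empty]
  refine hausdorffMeasure_eq_zero_of_closure_inter_nonempty hm hZnull (Γ := Γ) ?_ ?_
    (fun x hx => hx.2) fun A => ?_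
  · rintro x ⟨⟨-, hxW⟩, -⟩
    obtain ⟨c, t, ht, hcx⟩ := hΓex x hxW
    rw [hΓ x hxW c t ht hcx]
    exact c.ordConnected_I.isPreconnected.image _ fun s hs =>
      (c.isIntegral s hs).continuousAt.continuousWithinAt
  · rintro x ⟨⟨-, hxW⟩, -⟩
    obtain ⟨c, t, ht, hcx⟩ := hΓex x hxW
    rw [hΓ x hxW c t ht hcx]
    exact ⟨t, ht, hcx⟩
  · refine le_trans (measure_mono ?_)
      ((harea (A ∩ W₀) inter_subset_right).trans (measure_mono inter_subset_left))
    rintro x ⟨⟨hxE, -⟩, y, hyΓ, hyA⟩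
    have hyW₀ : y ∈ W₀ := hW₀ ▸ mem_biUnion hxE hyΓ
    obtain ⟨c, t, ht, hcx⟩ := hΓex x hxE.2
    rw [hΓ x hxE.2 c t ht hcx] at hyΓ
    obtain ⟨s, hs, hsy⟩ := hyΓ
    obtain ⟨hpE, hpΓ⟩ := hp y hyW₀
    rw [hΓ y (hsy ▸ c.mapsTo s hs) c s hs hsy] at hpΓ
    exact ⟨y, ⟨hyA, hyW₀⟩, hmult c ⟨hpE.1, hpΓ⟩ ⟨hxE.1, t, ht, hcx⟩⟩

end
end

section
/- (Localization of minimality for cones, as asserted at the beginning of Section 5.) Let 0 < d < N be integers, let C ⊆ ℝ^N be a closed cone (i.e. 0 ∈ C and tC = C for every t > 0) with ℋ^d(C ∩ B(0,1)) < ∞, and let U ⊆ ℝ^N be a bounded open convex set containing the origin. Then C is Almgren minimal of dimension d in ℝ^N if and only if C ∩ closure(U) is Almgren minimal of dimension d in U. -/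
open Set MeasureTheory Metric NNReal

section Deformations

open scoped Pointwise

variable {N : ℕ}

/-- The support condition of a deformation, in terms of a single compact set. -/
theorem isDeformation_support_iff {U : Set (EuclideanSpace ℝ (Fin N))}
    {φ : ℝ → EuclideanSpace ℝ (Fin N) → EuclideanSpace ℝ (Fin N)} :
    (closure (⋃ t ∈ Icc (0:ℝ) 1,
        ({x ∈ closure U | φ t x ≠ x} ∪ φ t '' {x ∈ closure U | φ t x ≠ x})) ⊆ U ∧
      IsCompact (closure (⋃ t ∈ Icc (0:ℝ) 1,
        ({x ∈ closure U | φ t x ≠ x} ∪ φ t '' {x ∈ closure U | φ t x ≠ x})))) ↔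
    ∃ K, IsCompact K ∧ K ⊆ U ∧
      ∀ t ∈ Icc (0:ℝ) 1, ∀ x ∈ closure U, φ t x ≠ x → x ∈ K ∧ φ t x ∈ K := by
  constructor
  · rintro ⟨hU, hK⟩
    refine ⟨_, hK, hU, fun t ht x hx hne => ⟨subset_closure ?_, subset_closure ?_⟩⟩
    · exact mem_biUnion ht (Or.inl ⟨hx, hne⟩)
    · exact mem_biUnion ht (Or.inr ⟨x, ⟨hx, hne⟩, rfl⟩)
  · rintro ⟨K, hK, hKU, h⟩
    have hsub : closure (⋃ t ∈ Icc (0:ℝ) 1,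
        ({x ∈ closure U | φ t x ≠ x} ∪ φ t '' {x ∈ closure U | φ t x ≠ x})) ⊆ K := by
      refine closure_minimal (iUnion₂_subset fun t ht => ?_) hK.isClosed
      rintro _ (⟨hx, hne⟩ | ⟨x, ⟨hx, hne⟩, rfl⟩)
      · exact (h t ht _ hx hne).1
      · exact (h t ht x hx hne).2
    exact ⟨hsub.trans hKU, hK.of_isClosed_subset isClosed_closure hsub⟩

theorem diff_image_inter_of_eqOn_id {α : Type*} {C V : Set α} {f g : α → α}
    (hfg : EqOn g f V) (hg : EqOn g id Vᶜ) :
    (C ∩ V) \ (f '' (C ∩ V)) = C \ (g '' C) := by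
  ext x
  constructor
  · rintro ⟨⟨hxC, hxV⟩, hx⟩
    refine ⟨hxC, ?_⟩
    rintro ⟨y, hy, rfl⟩
    by_cases hyV : y ∈ V
    · exact hx ⟨y, ⟨hy, hyV⟩, (hfg hyV).symm⟩
    · exact hyV (by simpa [hg hyV] using hxV)
  · rintro ⟨hxC, hx⟩
    have hxV : x ∈ V := by
      by_contra hxV
      exact hx ⟨x, hxC, hg hxV⟩
    refine ⟨⟨hxC, hxV⟩, ?_⟩
    rintro ⟨y, ⟨hy, hyV⟩, rfl⟩
    exact hx ⟨y, hy, hfg hyV⟩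

theorem image_inter_diff_of_eqOn_id {α : Type*} {C V : Set α} {f g : α → α}
    (hf : MapsTo f V V) (hfg : EqOn g f V) (hg : EqOn g id Vᶜ) :
    (f '' (C ∩ V)) \ (C ∩ V) = (g '' C) \ C := by
  ext x
  constructor
  · rintro ⟨⟨y, ⟨hy, hyV⟩, rfl⟩, hx⟩
    exact ⟨⟨y, hy, hfg hyV⟩, fun h => hx ⟨h, hf hyV⟩⟩
  · rintro ⟨⟨y, hy, rfl⟩, hx⟩
    by_cases hyV : y ∈ V
    · exact ⟨⟨y, ⟨hy, hyV⟩, (hfg hyV).symm⟩, fun h => hx h.1⟩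
    · exact absurd (by simpa [hg hyV] using hy) hx

open Classical in
/-- A deformation in `U`, extended by the identity, is a deformation in the whole space. -/
theorem IsDeformation.piecewise_id {U : Set (EuclideanSpace ℝ (Fin N))} (hU : IsOpen U)
    {φ : ℝ → EuclideanSpace ℝ (Fin N) → EuclideanSpace ℝ (Fin N)} (hφ : IsDeformation U φ) :
    IsDeformation univ fun t => (closure U).piecewise (φ t) id := by
  obtain ⟨-, h0, hcont, ⟨L, hL⟩, hsupp⟩ := hφ
  obtain ⟨K, hK, hKU, hmove⟩ := isDeformation_support_iff.1 hsupp
  have hid : ∀ t ∈ Icc (0:ℝ) 1, ∀ x ∉ K, (closure U).piecewise (φ t) id x = x := by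
    intro t ht x hx
    by_cases hxU : x ∈ closure U
    · rw [piecewise_eq_of_mem _ _ _ hxU]
      by_contra hne
      exact hx (hmove t ht x hxU hne).1
    · rw [piecewise_eq_of_notMem _ _ _ hxU, id]
  refine ⟨fun t _ x _ => by simp, fun x _ => ?_, ?_, ?_, ?_⟩
  · by_cases hxU : x ∈ closure U
    · simp [hxU, h0 x hxU]
    · simp [hxU]
  · have hcover : Icc (0:ℝ) 1 ×ˢ closure (univ : Set (EuclideanSpace ℝ (Fin N))) =
        Icc (0:ℝ) 1 ×ˢ closure U ∪ Icc (0:ℝ) 1 ×ˢ Uᶜ := by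
      rw [← prod_union, closure_univ, eq_comm, ← univ_subset_iff.1 (?_ : univ ⊆ closure U ∪ Uᶜ)]
      intro x _
      by_cases hx : x ∈ U
      exacts [Or.inl (subset_closure hx), Or.inr hx]
    rw [hcover]
    refine ContinuousOn.union_of_isClosed (hcont.congr ?_) (continuousOn_snd.congr ?_)
      (isClosed_Icc.prod isClosed_closure) (isClosed_Icc.prod hU.isClosed_compl)
    · rintro ⟨t, x⟩ ⟨-, hx⟩
      exact piecewise_eq_of_mem _ _ _ hx
    · rintro ⟨t, x⟩ ⟨ht, hx⟩
      exact hid t ht x fun h => hx (hKU h)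
  · obtain ⟨δ, hδ, hδU⟩ := hK.exists_thickening_subset_open hU hKU
    obtain ⟨D, hD⟩ := Metric.isBounded_iff.1 hK.isBounded
    have h1 : (1:ℝ) ∈ Icc (0:ℝ) 1 := by simp
    set g := (closure U).piecewise (φ 1) id
    have hfar : ∀ x y, y ∉ closure U → dist (g x) (g y) ≤ (max D 0 / δ + 1) * dist x y := by
      intro x y hy
      have hgy : g y = y := piecewise_eq_of_notMem _ _ _ hy
      have hC : 0 ≤ max D 0 / δ := div_nonneg (le_max_right _ _) hδ.le
      rw [hgy]
      by_cases hne : g x = x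
      · rw [hne]
        nlinarith [mul_nonneg hC (dist_nonneg (x := x) (y := y))]
      · have hxU : x ∈ closure U := by
          by_contra hxU
          exact hne (piecewise_eq_of_notMem _ _ _ hxU)
        have hgx : g x = φ 1 x := piecewise_eq_of_mem _ _ _ hxU
        obtain ⟨hx1, hx2⟩ := hmove 1 h1 x hxU (hgx ▸ hne)
        have hxy : δ ≤ dist x y := by
          by_contra! hlt
          exact hy (subset_closure (hδU (Metric.mem_thickening_iff.2
            ⟨x, hx1, by rwa [dist_comm]⟩)))
        have hd : dist (g x) x ≤ max D 0 := (hgx ▸ hD hx2 hx1).trans (le_max_left _ _)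
        have hmul : max D 0 ≤ max D 0 / δ * dist x y := by
          calc max D 0 = max D 0 / δ * δ := by field_simp
            _ ≤ _ := by gcongr
        linarith [dist_triangle (g x) x y]
    refine ⟨max L (Real.toNNReal (max D 0 / δ + 1)), LipschitzOnWith.of_dist_le_mul ?_⟩
    intro x _ y _
    have hle : max D 0 / δ + 1 ≤ ((max L (Real.toNNReal (max D 0 / δ + 1)) : ℝ≥0) : ℝ) :=
      (Real.le_coe_toNNReal _).trans (NNReal.coe_le_coe.2 (le_max_right _ _))
    by_cases hy : y ∈ closure U
    · by_cases hx : x ∈ closure U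
      · have := hL.dist_le_mul x hx y hy
        simp only [hx, hy, piecewise_eq_of_mem]
        refine this.trans (mul_le_mul_of_nonneg_right ?_ dist_nonneg)
        exact NNReal.coe_le_coe.2 (le_max_left _ _)
      · have := hfar y x hx
        rw [dist_comm, dist_comm x y]
        exact this.trans (mul_le_mul_of_nonneg_right hle dist_nonneg)
    · exact (hfar x y hy).trans (mul_le_mul_of_nonneg_right hle dist_nonneg)
  · refine isDeformation_support_iff.2 ⟨K, hK, subset_univ _, fun t ht x _ hne => ?_⟩
    have hxU : x ∈ closure U := by
      by_contra hxU
      exact hne (piecewise_eq_of_notMem _ _ _ hxU)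
    rw [piecewise_eq_of_mem _ _ _ hxU] at hne ⊢
    exact hmove t ht x hxU hne

/-- A deformation in the whole space is conjugated by a small homothety into a deformation
in a given neighbourhood of the origin. -/
theorem IsDeformation.exists_smul {U : Set (EuclideanSpace ℝ (Fin N))} (hU : IsOpen U)
    (h0U : (0 : EuclideanSpace ℝ (Fin N)) ∈ U)
    {φ : ℝ → EuclideanSpace ℝ (Fin N) → EuclideanSpace ℝ (Fin N)} (hφ : IsDeformation univ φ) :
    ∃ r : ℝ, 0 < r ∧ IsDeformation U (fun t x => r • φ t (r⁻¹ • x)) ∧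
      EqOn (fun x => r • φ 1 (r⁻¹ • x)) id (closure U)ᶜ := by
  obtain ⟨-, h0, hcont, ⟨L, hL⟩, hsupp⟩ := hφ
  obtain ⟨K, hK, -, hmove⟩ := isDeformation_support_iff.1 hsupp
  simp only [closure_univ, mem_univ, forall_const] at h0 hcont hL hmove
  obtain ⟨r, hr, hrK⟩ : ∃ r : ℝ, 0 < r ∧ r • K ⊆ U := by
    obtain ⟨ε, hε, hεU⟩ := Metric.isOpen_iff.1 hU 0 h0U
    obtain ⟨R, hR, hKR⟩ := hK.isBounded.subset_ball_lt 0 0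
    refine ⟨ε / R, by positivity, (smul_set_mono hKR).trans ?_⟩
    rw [_root_.smul_ball (by positivity), smul_zero, Real.norm_of_nonneg (by positivity),
      div_mul_cancel₀ _ hR.ne']
    exact hεU
  have hmove' : ∀ t ∈ Icc (0:ℝ) 1, ∀ x, r • φ t (r⁻¹ • x) ≠ x →
      x ∈ r • K ∧ r • φ t (r⁻¹ • x) ∈ r • K := by
    intro t ht x hne
    have := hmove t ht (r⁻¹ • x) fun h => hne (by rw [h, smul_inv_smul₀ hr.ne'])
    exact ⟨(mem_smul_set_iff_inv_smul_mem₀ hr.ne' _ _).2 this.1, smul_mem_smul_set this.2⟩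
  refine ⟨r, hr, ⟨fun t ht x hx => ?_, fun x _ => ?_, ?_, ⟨L, ?_⟩, ?_⟩, fun x hx => ?_⟩
  · by_cases hne : r • φ t (r⁻¹ • x) = x
    · simpa only [hne] using hx
    · exact subset_closure (hrK (hmove' t ht x hne).2)
  · simp only [h0, smul_inv_smul₀ hr.ne']
  · refine ContinuousOn.const_smul (hcont.comp (f := fun p : ℝ × EuclideanSpace ℝ (Fin N) =>
      (p.1, r⁻¹ • p.2)) (by fun_prop) ?_) r
    exact fun p hp => ⟨hp.1, mem_univ _⟩
  · refine LipschitzOnWith.of_dist_le_mul fun x _ y _ => ?_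
    have := hL.dist_le_mul (r⁻¹ • x) (mem_univ _) (r⁻¹ • y) (mem_univ _)
    rw [dist_smul₀, Real.norm_of_nonneg (inv_nonneg.2 hr.le)] at this
    rw [dist_smul₀, Real.norm_of_nonneg hr.le]
    calc r * dist (φ 1 (r⁻¹ • x)) (φ 1 (r⁻¹ • y)) ≤ r * (L * (r⁻¹ * dist x y)) := by gcongr
      _ = L * dist x y := by field_simp
  · exact isDeformation_support_iff.2
      ⟨r • K, hK.smul r, hrK, fun t ht x _ hne => hmove' t ht x hne⟩
  · by_contra hne
    exact hx (subset_closure (hrK (hmove' 1 (by simp) x hne).1))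

/-- A cone of finite measure in the unit ball has finite measure in every ball. -/
theorem hausdorffMeasure_cone_inter_closedBall_lt_top {d : ℝ} (hd : 0 ≤ d)
    {C : Set (EuclideanSpace ℝ (Fin N))} (hcone : ∀ t : ℝ, 0 < t → t • C = C)
    (hfin : μH[d] (C ∩ ball 0 1) < ⊤) (x : EuclideanSpace ℝ (Fin N)) (r : ℝ) :
    μH[d] (C ∩ closedBall x r) < ⊤ := by
  obtain ⟨R, hR, hsub⟩ := (isBounded_closedBall (x := x) (r := r)).subset_ball_lt 0 0
  have hscale : C ∩ ball 0 R = R • (C ∩ ball 0 1) := by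
    rw [smul_set_inter₀ hR.ne', hcone R hR, _root_.smul_ball hR.ne', smul_zero,
      Real.norm_of_nonneg hR.le, mul_one]
  refine (measure_mono (inter_subset_inter_right C hsub)).trans_lt ?_
  rw [hscale, Measure.hausdorffMeasure_smul₀ hd hR.ne']
  exact ENNReal.mul_lt_top ENNReal.coe_lt_top hfin

end Deformations

open Pointwise in
/-- Let C ⊆ ℝ^N be a closed cone of dimension d (0 < d < N) with
ℋ^d(C ∩ B(0,1)) < ∞, and let U be a bounded open convex set containing the origin. Then C
is Almgren minimal of dimension d in ℝ^N iff C ∩ closure U is Almgren minimal of dimension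
d in U. -/
theorem cone_minimal_iff_minimal_in_convex_domain (N d : ℕ) (hd0 : 0 < d) (hdN : d < N)
    (C : Set (EuclideanSpace ℝ (Fin N))) (hC : IsClosed C) (h0C : (0 : EuclideanSpace ℝ (Fin N)) ∈ C)
    (hcone : ∀ t : ℝ, 0 < t → t • C = C)
    (hfin : μH[(d : ℝ)] (C ∩ Metric.ball 0 1) < ⊤)
    (U : Set (EuclideanSpace ℝ (Fin N))) (hUopen : IsOpen U)
    (hUbdd : Bornology.IsBounded U) (hUconv : Convex ℝ U)
    (h0U : (0 : EuclideanSpace ℝ (Fin N)) ∈ U) :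
    AlmgrenMinimal ((d : ℕ) : ℝ) Set.univ C ↔
      AlmgrenMinimal ((d : ℕ) : ℝ) U (C ∩ closure U) := by
  constructor
  · classical
    rintro ⟨-, -, hball, hmin⟩
    refine ⟨hC.inter isClosed_closure, inter_subset_right, fun x r _ =>
      (measure_mono (inter_subset_inter_left _ inter_subset_left)).trans_lt
        (hball x r (subset_univ _)), fun φ hφ => ?_⟩
    have hmaps := hφ.1 1 (by simp)
    have heq : EqOn ((closure U).piecewise (φ 1) id) (φ 1) (closure U) := piecewise_eqOn _ _ _
    have hid : EqOn ((closure U).piecewise (φ 1) id) id (closure U)ᶜ := piecewise_eqOn_compl _ _ _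
    rw [diff_image_inter_of_eqOn_id heq hid, image_inter_diff_of_eqOn_id hmaps heq hid]
    have h := hmin _ (hφ.piecewise_id hUopen)
    exact h
  · rintro ⟨-, -, -, hmin⟩
    refine ⟨hC, by simp, fun x r _ =>
      hausdorffMeasure_cone_inter_closedBall_lt_top d.cast_nonneg hcone hfin x r, fun φ hφ => ?_⟩
    obtain ⟨r, hr, hψ, hid⟩ := hφ.exists_smul hUopen h0U
    have hmaps := hψ.1 1 (by simp)
    have himage : (fun x => r • φ 1 (r⁻¹ • x)) '' C = r • (φ 1 '' C) := by
      conv_rhs => rw [← hcone r⁻¹ (inv_pos.2 hr)]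
      simp only [← image_smul, image_image]
    have h := hmin _ hψ
    rw [diff_image_inter_of_eqOn_id (eqOn_refl _ _) hid,
      image_inter_diff_of_eqOn_id hmaps (eqOn_refl _ _) hid, himage] at h
    have hscale : ∀ A B : Set (EuclideanSpace ℝ (Fin N)), r • A \ r • B = r • (A \ B) :=
      fun A B => (smul_set_sdiff₀ hr.ne').symm
    have hl : C \ r • (φ 1 '' C) = r • (C \ φ 1 '' C) := by rw [← hscale, hcone r hr]
    have hrr : r • (φ 1 '' C) \ C = r • (φ 1 '' C \ C) := by rw [← hscale, hcone r hr]
    rw [hl, hrr, Measure.hausdorffMeasure_smul₀ d.cast_nonneg hr.ne',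
      Measure.hausdorffMeasure_smul₀ d.cast_nonneg hr.ne'] at h
    refine (ENNReal.mul_le_mul_iff_right ?_ ENNReal.coe_ne_top).1 h
    exact ENNReal.coe_ne_zero.2 (NNReal.rpow_pos (nnnorm_pos.2 hr.ne')).ne'
end

section
/- (Key step in Proposition 5.1 and Theorem 3.4 4°: a curve that always crosses an interface in the same direction meets it at most once.) Let X be a topological space, E ⊆ X a closed set, and D₁, D₂ disjoint open subsets of X with X \ E = D₁ ∪ D₂. Let I ⊆ ℝ be an interval and γ : I → X a continuous map. Assume that for every t ∈ I with γ(t) ∈ E there exists η > 0 such that γ(s) ∈ D₁ for all s ∈ (t−η, t) ∩ I and γ(s) ∈ D₂ for all s ∈ (t, t+η) ∩ I. Then there is at most one t ∈ I with γ(t) ∈ E; in particular γ meets E in at most one point. -/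
open Set

/-- A continuous curve that can leave `D₁ᶜ` neither from `D₂` (which is open) nor from `E`
(after which it lies in `D₂`) stays in `D₁ᶜ` once it has been there. -/
theorem Icc_subset_preimage_compl_of_forall_exists_Ioo {X : Type*} [TopologicalSpace X]
    {E D₁ D₂ : Set X} (hD₁ : IsOpen D₁) (hD₂ : IsOpen D₂) (hdisj : Disjoint D₁ D₂)
    (hcompl : Eᶜ ⊆ D₁ ∪ D₂) {a b : ℝ} {γ : ℝ → X} (hγ : ContinuousOn γ (Icc a b))
    (hcross : ∀ t ∈ Icc a b, γ t ∈ E → ∃ η > (0 : ℝ),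
      ∀ s ∈ Icc a b, s ∈ Ioo t (t + η) → γ s ∈ D₂)
    (ha : γ a ∉ D₁) : Icc a b ⊆ γ ⁻¹' D₁ᶜ := by
  rcases lt_or_ge b a with hab | hab
  · simp [Icc_eq_empty_of_lt hab]
  have hclosed : IsClosed (γ ⁻¹' D₁ᶜ ∩ Icc a b) := by
    rw [inter_comm]
    exact hγ.preimage_isClosed_of_isClosed isClosed_Icc hD₁.isClosed_compl
  refine hclosed.Icc_subset_of_forall_exists_gt ha fun x hx y hy => ?_
  obtain ⟨hxD, hxab⟩ := hx
  have hxI : x ∈ Icc a b := Ico_subset_Icc_self hxab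
  have hright : ∃ η > (0 : ℝ), ∀ s ∈ Icc a b, s ∈ Ioo x (x + η) → γ s ∈ D₂ := by
    by_cases hxE : γ x ∈ E
    · exact hcross x hxI hxE
    · have hxD₂ : γ x ∈ D₂ := (hcompl hxE).resolve_left hxD
      obtain ⟨η, hη, hball⟩ :=
        Metric.mem_nhdsWithin_iff.1 (hγ x hxI (hD₂.mem_nhds hxD₂))
      refine ⟨η, hη, fun s hs hsx => hball ⟨?_, hs⟩⟩
      rw [Real.ball_eq_Ioo]
      exact ⟨by linarith [hsx.1], hsx.2⟩
  obtain ⟨η, hη, hD⟩ := hright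
  obtain ⟨s, hxs, hs⟩ : ∃ s, x < s ∧ s < min (min y b) (x + η) :=
    exists_between (lt_min (lt_min hy hxab.2) (by linarith))
  simp only [lt_min_iff] at hs
  exact ⟨s, hdisj.notMem_of_mem_right (hD s ⟨hxab.1.trans hxs.le, hs.1.2.le⟩ ⟨hxs, hs.2⟩),
    hxs, hs.1.1.le⟩

/-- Let X be a topological space, E ⊆ X closed, and D₁, D₂ disjoint open sets
with X \ E = D₁ ∪ D₂.  Let I ⊆ ℝ be an interval and γ : I → X continuous.  If whenever
γ(t) ∈ E the curve lies in D₁ just before t and in D₂ just after t, then γ meets E for at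
most one parameter value; in particular γ meets E in at most one point. -/
theorem curve_crossing_once {X : Type*} [TopologicalSpace X]
    (E D₁ D₂ : Set X) (hE : IsClosed E) (hD₁ : IsOpen D₁) (hD₂ : IsOpen D₂)
    (hdisj : Disjoint D₁ D₂) (hcompl : Eᶜ = D₁ ∪ D₂)
    (I : Set ℝ) (hI : I.OrdConnected) (γ : ℝ → X) (hγ : ContinuousOn γ I)
    (hcross : ∀ t ∈ I, γ t ∈ E → ∃ η > (0:ℝ),
      (∀ s ∈ I, s ∈ Ioo (t - η) t → γ s ∈ D₁) ∧
      (∀ s ∈ I, s ∈ Ioo t (t + η) → γ s ∈ D₂)) :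
    (∀ t₁ ∈ I, ∀ t₂ ∈ I, γ t₁ ∈ E → γ t₂ ∈ E → t₁ = t₂) ∧
      ({x ∈ E | ∃ t ∈ I, γ t = x}).Subsingleton := by
  have hED₁ : ∀ x ∈ E, x ∉ D₁ := fun x hx hx₁ =>
    (hcompl.symm.subset (Or.inl hx₁) : x ∈ Eᶜ) hx
  have hlt : ∀ t₁ ∈ I, ∀ t₂ ∈ I, γ t₁ ∈ E → γ t₂ ∈ E → ¬ t₁ < t₂ := by
    intro t₁ h₁ t₂ h₂ hE₁ hE₂ h
    have hsub : Icc t₁ t₂ ⊆ I := hI.out h₁ h₂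
    have hstay : Icc t₁ t₂ ⊆ γ ⁻¹' D₁ᶜ :=
      Icc_subset_preimage_compl_of_forall_exists_Ioo hD₁ hD₂ hdisj hcompl.subset (hγ.mono hsub)
        (fun t ht htE =>
          let ⟨η, hη, _, hr⟩ := hcross t (hsub ht) htE
          ⟨η, hη, fun s hs => hr s (hsub hs)⟩)
        (hED₁ _ hE₁)
    obtain ⟨η, hη, hl, -⟩ := hcross t₂ h₂ hE₂
    obtain ⟨s, hs, hst⟩ : ∃ s, max t₁ (t₂ - η) < s ∧ s < t₂ :=
      exists_between (max_lt h (by linarith))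
    rw [max_lt_iff] at hs
    have hsI : s ∈ Icc t₁ t₂ := ⟨hs.1.le, hst.le⟩
    exact hstay hsI (hl s (hsub hsI) ⟨hs.2, hst⟩)
  have huniq : ∀ t₁ ∈ I, ∀ t₂ ∈ I, γ t₁ ∈ E → γ t₂ ∈ E → t₁ = t₂ :=
    fun t₁ h₁ t₂ h₂ hE₁ hE₂ => le_antisymm
      (not_lt.1 (hlt t₂ h₂ t₁ h₁ hE₂ hE₁)) (not_lt.1 (hlt t₁ h₁ t₂ h₂ hE₁ hE₂))
  refine ⟨huniq, ?_⟩
  rintro _ ⟨hE₁, t₁, h₁, rfl⟩ _ ⟨hE₂, t₂, h₂, rfl⟩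
  rw [huniq t₁ h₁ t₂ h₂ hE₁ hE₂]
end
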